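/- arXiv:2410.23431 — 2 statements merged into one kernel-verified Lean document; each statement's English description precedes it below -/
import Mathlib

section
/- Let M be a bounded graph matroid family. Then M has the Whitney property if and only if there is a small M-circuit with minimum degree one. -/
/-!
Common framework: graph matroid families.

A finite simple graph (without isolated vertices) is identified with its edge
set: a finite set of non-diagonal elements of `Sym2 ℕ`.  A graph matroid
family is encoded, following the paper, as a finitary matroid on the edge set
of the countable complete graph on `ℕ` that is invariant under all
permutations of `ℕ`.
-/

/-- The set of vertices covered by a set of edges. -/
def eSupp (E : Set (Sym2 ℕ)) : Set ℕ := {v : ℕ | ∃ e ∈ E, v ∈ e}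

/-- The edge set of the complete graph on the vertex set `V`. -/
def clique (V : Set ℕ) : Set (Sym2 ℕ) := {e : Sym2 ℕ | ¬ e.IsDiag ∧ ∀ v ∈ e, v ∈ V}

/-- The edge set of the complete graph `K_n` on the vertices `0, …, n-1`. -/
def cliqueN (n : ℕ) : Set (Sym2 ℕ) := clique {v : ℕ | v < n}

/-- `E` is (the edge set of) a finite simple graph. -/
def IsGraph (E : Set (Sym2 ℕ)) : Prop := E.Finite ∧ ∀ e ∈ E, ¬ e.IsDiag

/-- The degree of the vertex `v` in the edge set `E`. -/
noncomputable def deg (E : Set (Sym2 ℕ)) (v : ℕ) : ℕ := {e ∈ E | v ∈ e}.ncard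

/-- The minimum degree of (the graph with) edge set `E` (whose vertex set is `eSupp E`). -/
noncomputable def minDeg (E : Set (Sym2 ℕ)) : ℕ := sInf {k : ℕ | ∃ v ∈ eSupp E, deg E v = k}

/-- Deleting a set `S` of vertices from the graph with edge set `E`. -/
def deleteVerts (E : Set (Sym2 ℕ)) (S : Set ℕ) : Set (Sym2 ℕ) := {e ∈ E | ∀ v ∈ e, v ∉ S}

/-- The graph with edge set `E` is `k`-connected: it has more than `k` vertices and
deleting any set of fewer than `k` vertices leaves a connected graph. -/
def KConnected (k : ℕ) (E : Set (Sym2 ℕ)) : Prop :=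
  k < (eSupp E).ncard ∧
  ∀ S : Finset ℕ, S.card < k →
    ((SimpleGraph.fromEdgeSet E).induce (eSupp E \ ↑S)).Connected

/-- `E` is a forest. -/
def IsForest (E : Set (Sym2 ℕ)) : Prop := (SimpleGraph.fromEdgeSet E).IsAcyclic

/-- `E` is a matching: no two distinct edges of `E` share a vertex. -/
def IsMatching (E : Set (Sym2 ℕ)) : Prop :=
  ∀ e ∈ E, ∀ f ∈ E, e ≠ f → ∀ v : ℕ, v ∈ e → v ∉ f

/-- `E` is a star `K_{1,m}` with `m` edges. -/
def IsStar (m : ℕ) (E : Set (Sym2 ℕ)) : Prop :=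
  ∃ (c : ℕ) (L : Finset ℕ), c ∉ L ∧ L.card = m ∧ E = (fun x => s(c, x)) '' ↑L

/-- `C` is a cycle graph `C_n` for some `n ≥ 3`. -/
def IsCycleGraph (C : Set (Sym2 ℕ)) : Prop :=
  ∃ n : ℕ, 3 ≤ n ∧ ∃ f : ZMod n → ℕ, Function.Injective f ∧
    C = {e : Sym2 ℕ | ∃ i : ZMod n, e = s(f i, f (i + 1))}

/-- The rank of the set `X` in the matroid `M₀`: the supremum of the cardinalities of
independent subsets of `X` (as a natural number; all sets we use are finite). -/
noncomputable def mrk (M₀ : Matroid (Sym2 ℕ)) (X : Set (Sym2 ℕ)) : ℕ :=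
  sSup {n : ℕ | ∃ I ⊆ X, M₀.Indep I ∧ I.ncard = n}

/-- A vertical `k`-separation of the matroid `M₀`. -/
def VerticalSep (M₀ : Matroid (Sym2 ℕ)) (k : ℕ) (E₁ E₂ : Set (Sym2 ℕ)) : Prop :=
  Disjoint E₁ E₂ ∧ E₁ ∪ E₂ = M₀.E ∧
  k ≤ mrk M₀ E₁ ∧ k ≤ mrk M₀ E₂ ∧
  mrk M₀ E₁ + mrk M₀ E₂ + 1 ≤ mrk M₀ M₀.E + k

/-- The matroid `M₀` is vertically `k`-connected. -/
def VerticallyConnected (M₀ : Matroid (Sym2 ℕ)) (k : ℕ) : Prop :=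
  k ≤ mrk M₀ M₀.E ∧
  ∀ k' : ℕ, 0 < k' → k' < k → ∀ E₁ E₂ : Set (Sym2 ℕ), ¬ VerticalSep M₀ k' E₁ E₂

/-- A `d`-dimensional abstract rigidity matroid on the complete graph with vertex set `V`. -/
def IsARM (d : ℕ) (V : Set ℕ) (M₀ : Matroid (Sym2 ℕ)) : Prop :=
  M₀.E = clique V ∧
  (∀ E₁ E₂ : Set (Sym2 ℕ), E₁ ⊆ clique V → E₂ ⊆ clique V →
      (eSupp E₁ ∩ eSupp E₂).ncard < d →
      M₀.closure (E₁ ∪ E₂) = M₀.closure E₁ ∪ M₀.closure E₂) ∧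
  (∀ E₁ E₂ : Set (Sym2 ℕ), E₁ ⊆ clique V → E₂ ⊆ clique V →
      d ≤ (eSupp E₁ ∩ eSupp E₂).ncard →
      M₀.closure E₁ = clique (eSupp E₁) → M₀.closure E₂ = clique (eSupp E₂) →
      M₀.closure (E₁ ∪ E₂) = clique (eSupp E₁ ∪ eSupp E₂))

/-- The `d`-dimensional edge split operation: replace an edge `uv` of `G` by a new
vertex `w` joined to `u` and `v`, as well as to `d - 1` other vertices of `G`. -/
def EdgeSplit (d : ℕ) (G G' : Set (Sym2 ℕ)) : Prop :=
  ∃ (u v w : ℕ) (X : Finset ℕ),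
    s(u, v) ∈ G ∧ w ∉ eSupp G ∧ ↑X ⊆ eSupp G ∧ X.card = d - 1 ∧ u ∉ X ∧ v ∉ X ∧
    G' = (G \ {s(u, v)}) ∪ {s(w, u), s(w, v)} ∪ ((fun x => s(w, x)) '' ↑X)

/-- A graph matroid family: a finitary matroid on the edge set of the countable
complete graph on `ℕ`, invariant under all permutations of `ℕ`. -/
structure GraphMatroidFamily where
  /-- The underlying matroid on the edge set of `K_ℕ`. -/
  M : Matroid (Sym2 ℕ)
  ground_eq : M.E = {e : Sym2 ℕ | ¬ e.IsDiag}
  finitary : M.Finitary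
  invariant : ∀ σ : Equiv.Perm ℕ, ∀ I : Set (Sym2 ℕ),
    M.Indep I → M.Indep (Sym2.map σ '' I)

namespace GraphMatroidFamily

variable (M : GraphMatroidFamily)

/-- The rank function of the family: `M.rk E` is the rank of the matroid `M(G)` for
any graph `G` whose edge set contains `E`. -/
noncomputable def rk (E : Set (Sym2 ℕ)) : ℕ := mrk M.M E

/-- A set of edges (a graph) is `M`-independent. -/
def Indep (E : Set (Sym2 ℕ)) : Prop := M.M.Indep E

/-- `C` is an `M`-circuit: a graph that is not `M`-independent, but such that deleting
any single edge from it yields an `M`-independent graph. -/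
def IsCircuit (C : Set (Sym2 ℕ)) : Prop :=
  IsGraph C ∧ ¬ M.Indep C ∧ ∀ e ∈ C, M.Indep (C \ {e})

/-- The graph with edge set `E` is `M`-rigid. -/
def Rigid (E : Set (Sym2 ℕ)) : Prop := M.rk E = M.rk (clique (eSupp E))

/-- The graph with vertex set `V` and edge set `E` is `M`-rigid. -/
def RigidOn (V : Set ℕ) (E : Set (Sym2 ℕ)) : Prop := M.rk E = M.rk (clique V)

/-- `M` is trivial if every (finite, simple) graph is `M`-independent. -/
def Trivial : Prop := ∀ E : Set (Sym2 ℕ), IsGraph E → M.Indep E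

/-- `M` is unbounded: the sequence `r(K_n)` is unbounded. -/
def Unbounded : Prop := ∀ B : ℕ, ∃ n : ℕ, B < M.rk (cliqueN n)

/-- `M` is bounded: the sequence `r(K_n)` is bounded. -/
def Bounded : Prop := ∃ B : ℕ, ∀ n : ℕ, M.rk (cliqueN n) ≤ B

/-- For a bounded family, `m` is the rank `r(M)` of `M`: the maximum (limit) of the
monotone sequence `r(K_n)`. -/
def HasRank (m : ℕ) : Prop :=
  (∀ n : ℕ, M.rk (cliqueN n) ≤ m) ∧ ∃ n : ℕ, M.rk (cliqueN n) = m

/-- `d` is the dimensionality of (the nontrivial family) `M`: the least `d` such that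
there is an `M`-circuit with minimum degree `d + 1`. -/
def IsDimensionality (d : ℕ) : Prop :=
  IsLeast {d : ℕ | ∃ C, M.IsCircuit C ∧ minDeg C = d + 1} d

/-- `t` is the threshold of (the nontrivial family) `M` with dimensionality `d`:
the least value of `|V(C)| - 1` over all `M`-circuits `C` with minimum degree `d + 1`. -/
def IsThreshold (d t : ℕ) : Prop :=
  IsLeast {t : ℕ | ∃ C, M.IsCircuit C ∧ minDeg C = d + 1 ∧ (eSupp C).ncard = t + 1} t

/-- `M` has the Lovász–Yemini property. -/
def LovaszYemini : Prop :=
  ∃ c : ℕ, ∀ E : Set (Sym2 ℕ), IsGraph E → KConnected c E → M.Rigid E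

/-- `ψ` is an isomorphism between the matroids `M(G)` and `M(H)`. -/
def MatroidIso (G H : Set (Sym2 ℕ)) (ψ : Sym2 ℕ → Sym2 ℕ) : Prop :=
  Set.BijOn ψ G H ∧ ∀ S ⊆ G, (M.Indep S ↔ M.Indep (ψ '' S))

/-- `G` is `M`-reconstructible: every isomorphism between `M(G)` and `M(H)` (for a graph
`H` without isolated vertices) is induced by a graph isomorphism. -/
def Reconstructible (G : Set (Sym2 ℕ)) : Prop :=
  ∀ H : Set (Sym2 ℕ), IsGraph H → ∀ ψ : Sym2 ℕ → Sym2 ℕ, M.MatroidIso G H ψ →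
    ∃ φ : ℕ → ℕ, Set.BijOn φ (eSupp G) (eSupp H) ∧ ∀ e ∈ G, ψ e = Sym2.map φ e

/-- `M` has the Whitney property. -/
def Whitney : Prop :=
  ∃ c : ℕ, ∀ E : Set (Sym2 ℕ), IsGraph E → KConnected c E → M.Reconstructible E

/-- `M` is the union of the graph matroid families `Ms`. -/
def IsUnionOf {k : ℕ} (Ms : Fin k → GraphMatroidFamily) : Prop :=
  ∀ I : Set (Sym2 ℕ),
    M.Indep I ↔ ∃ Is : Fin k → Set (Sym2 ℕ), (∀ i, (Ms i).Indep (Is i)) ∧ I = ⋃ i, Is i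

/-- `M` is a family of `d`-dimensional abstract rigidity matroids. -/
def FamilyOfARM (d : ℕ) : Prop :=
  ∀ n : ℕ, d ≤ n → IsARM d {v : ℕ | v < n} (M.M.restrict (cliqueN n))

/-- `M` is `1`-extendable: its dimensionality `d` is finite and positive, and the
`d`-dimensional edge split operation preserves `M`-independence. -/
def OneExtendable : Prop :=
  ∃ d : ℕ, 0 < d ∧ M.IsDimensionality d ∧
    ∀ G G' : Set (Sym2 ℕ), IsGraph G → M.Indep G → EdgeSplit d G G' → M.Indep G'

/-- `G` is `k`-vertex-redundantly `M`-rigid. -/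
def VertexRedundantlyRigid (k : ℕ) (G : Set (Sym2 ℕ)) : Prop :=
  M.Rigid G ∧ ∀ S : Finset ℕ, ↑S ⊆ eSupp G → S.card ≤ k →
    M.RigidOn (eSupp G \ ↑S) (deleteVerts G ↑S)

end GraphMatroidFamily

namespace BW

open Set

lemma transfer {N : Matroid (Sym2 ℕ)} {G : Set (Sym2 ℕ)} {f : Sym2 ℕ → Sym2 ℕ}
    (hf : ∀ e ∈ G, f e ∈ N.E)
    (hI : ∀ S ⊆ G, (N.Indep S ↔ N.Indep (f '' S))) {X : Set (Sym2 ℕ)} {e : Sym2 ℕ}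
    (hX : X ⊆ G) (he : e ∈ G) (h : e ∈ N.closure X) : f e ∈ N.closure (f '' X) := by
  by_cases heX : e ∈ X
  · exact N.mem_closure_of_mem' (mem_image_of_mem f heX) (hf e he)
  obtain ⟨C, hCX, hC, heC⟩ := N.exists_isCircuit_of_mem_closure h heX
  have hCG : C ⊆ G := hCX.trans (insert_subset he hX)
  have hJ := hC.sdiff_singleton_indep heC
  have hJ' : N.Indep (f '' (C \ {e})) := (hI _ (sdiff_subset.trans hCG)).1 hJ
  have hsub : f '' (C \ {e}) ⊆ f '' X := by
    apply image_mono
    intro x hx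
    rcases hCX hx.1 with h | h
    · exact absurd h hx.2
    · exact h
  apply N.closure_subset_closure hsub
  rw [hJ'.mem_closure_iff]
  left
  have heq : insert (f e) (f '' (C \ {e})) = f '' C := by
    rw [← image_insert_eq, insert_sdiff_singleton, insert_eq_of_mem heC]
  rw [heq]
  refine ⟨fun hh => hC.not_indep ((hI _ hCG).2 hh), ?_⟩
  rintro _ ⟨x, hx, rfl⟩
  exact hf x (hCG hx)

variable (M : GraphMatroidFamily)

lemma mem_E {e : Sym2 ℕ} : e ∈ M.M.E ↔ ¬ e.IsDiag := by
  rw [M.ground_eq]; rfl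

lemma isDiag_map (σ : Equiv.Perm ℕ) (e : Sym2 ℕ) : (e.map σ).IsDiag ↔ e.IsDiag := by
  induction e with | _ x y => simp

lemma indep_map_iff (σ : Equiv.Perm ℕ) (S : Set (Sym2 ℕ)) :
    M.M.Indep S ↔ M.M.Indep (Sym2.map σ '' S) := by
  refine ⟨M.invariant σ S, fun h => ?_⟩
  have := M.invariant σ⁻¹ _ h
  rw [← image_comp, ← Sym2.map_comp] at this
  have h2 : ((σ⁻¹ : Equiv.Perm ℕ) : ℕ → ℕ) ∘ σ = id := by ext; simp
  rw [h2] at this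
  simpa using this

lemma closure_map (σ : Equiv.Perm ℕ) {X : Set (Sym2 ℕ)} {e : Sym2 ℕ}
    (h : e ∈ M.M.closure X) : e.map σ ∈ M.M.closure (Sym2.map σ '' X) := by
  have he := M.M.mem_ground_of_mem_closure h
  rw [← M.M.closure_inter_ground] at h
  have := transfer (N := M.M) (G := M.M.E) (f := Sym2.map σ)
    (fun e he => by rw [mem_E, isDiag_map]; exact (mem_E M).1 he)
    (fun S _ => indep_map_iff M σ S) inter_subset_right he h
  exact M.M.closure_subset_closure (image_mono inter_subset_left) this

/-- If `σ` fixes all vertices of `X` then it fixes `X`. -/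
lemma map_fix (σ : Equiv.Perm ℕ) {X : Set (Sym2 ℕ)} (h : ∀ v ∈ eSupp X, σ v = v) :
    Sym2.map σ '' X = X := by
  have : ∀ e ∈ X, e.map σ = e := by
    intro e he
    induction e with | _ x y =>
    have hx := h x ⟨_, he, by simp⟩
    have hy := h y ⟨_, he, by simp⟩
    simp [hx, hy]
  ext e
  constructor
  · rintro ⟨x, hx, rfl⟩; rw [this x hx]; exact hx
  · intro he; exact ⟨e, he, this e he⟩

lemma eSupp_finite {X : Set (Sym2 ℕ)} (h : X.Finite) : (eSupp X).Finite := by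
  have : eSupp X = ⋃ e ∈ X, {v | v ∈ e} := by ext; simp [eSupp]
  rw [this]
  refine h.biUnion fun e _ => ?_
  induction e with | _ x y =>
  refine (Set.toFinite {x, y}).subset ?_
  intro v hv; simpa using hv

lemma bdd {X : Set (Sym2 ℕ)} (h : X.Finite) : ∃ n, ∀ v ∈ eSupp X, v < n := by
  obtain ⟨n, hn⟩ := (eSupp_finite h).bddAbove
  exact ⟨n + 1, fun v hv => Nat.lt_succ_of_le (hn hv)⟩

lemma cliqueN_finite (n : ℕ) : (cliqueN n).Finite := by
  have : cliqueN n ⊆ (fun p : ℕ × ℕ => s(p.1, p.2)) '' (Set.Iio n ×ˢ Set.Iio n) := by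
    intro e he
    induction e with | _ x y =>
    exact ⟨(x, y), ⟨he.2 x (by simp), he.2 y (by simp)⟩, rfl⟩
  exact (((finite_Iio n).prod (finite_Iio n)).image _).subset this

variable {M} {m₀ : ℕ}

lemma indep_le (h : M.HasRank m₀) {I : Set (Sym2 ℕ)} (hI : M.M.Indep I) :
    I.encard ≤ m₀ := by
  have fin : ∀ J : Set (Sym2 ℕ), M.M.Indep J → J.Finite → J.ncard ≤ m₀ := by
    intro J hJ hf
    obtain ⟨n, hn⟩ := bdd hf
    refine le_trans ?_ (h.1 n)
    have hsub : J ⊆ cliqueN n := fun e he =>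
      ⟨(mem_E M).1 (hJ.subset_ground he), fun v hv => hn v ⟨e, he, hv⟩⟩
    refine le_csSup ⟨(cliqueN n).ncard, ?_⟩ ⟨J, hsub, hJ, rfl⟩
    rintro k ⟨I, hIs, -, rfl⟩
    exact ncard_le_ncard hIs (cliqueN_finite n)
  by_contra hcon
  push Not at hcon
  have h1 : ((m₀ + 1 : ℕ) : ℕ∞) ≤ I.encard := by
    push_cast
    exact Order.add_one_le_of_lt hcon
  obtain ⟨J, hJI, hJ⟩ := exists_subset_encard_eq h1
  have hJf : J.Finite := finite_of_encard_eq_coe hJ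
  have := fin J (hI.subset hJI) hJf
  rw [← Nat.cast_le (α := ℕ∞), hJf.cast_ncard_eq, hJ, Nat.cast_le] at this
  omega

lemma eRank_eq (h : M.HasRank m₀) : M.M.eRank = m₀ := by
  apply le_antisymm
  · obtain ⟨B, hB⟩ := M.M.exists_isBase
    rw [← hB.encard_eq_eRank]
    exact indep_le h hB.indep
  · obtain ⟨n, hn⟩ := h.2
    have hne : {k : ℕ | ∃ I ⊆ cliqueN n, M.M.Indep I ∧ I.ncard = k}.Nonempty :=
      ⟨0, ∅, empty_subset _, M.M.empty_indep, by simp⟩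
    have hb : BddAbove {k : ℕ | ∃ I ⊆ cliqueN n, M.M.Indep I ∧ I.ncard = k} := by
      refine ⟨(cliqueN n).ncard, ?_⟩
      rintro k ⟨I, hIs, -, rfl⟩
      exact ncard_le_ncard hIs (cliqueN_finite n)
    obtain ⟨I, hIs, hI, hc⟩ := Nat.sSup_mem hne hb
    have hc' : I.ncard = m₀ := hc.trans hn
    rw [← hc', ((cliqueN_finite n).subset hIs).cast_ncard_eq]
    exact hI.encard_le_eRank

lemma rankFinite (h : M.HasRank m₀) : M.M.RankFinite := by
  rw [← Matroid.eRank_lt_top_iff, eRank_eq h]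
  exact ENat.natCast_lt_top m₀

lemma indep_finite (h : M.HasRank m₀) {I : Set (Sym2 ℕ)} (hI : M.M.Indep I) : I.Finite := by
  have := rankFinite h
  exact hI.finite

/-- Spanning sets have rank `m₀`. -/
lemma base_of_closure (h : M.HasRank m₀) {X : Set (Sym2 ℕ)} (hX : X ⊆ M.M.E)
    (hc : M.M.E ⊆ M.M.closure X) : ∃ I ⊆ X, M.M.Indep I ∧ I.encard = m₀ := by
  have hs : M.M.Spanning X := (Matroid.spanning_iff_ground_subset_closure hX).2 hc
  obtain ⟨B, hB, hBX⟩ := hs.exists_isBase_subset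
  exact ⟨B, hBX, hB.indep, hB.encard_eq_eRank.trans (eRank_eq h)⟩

lemma closure_of_indep (h : M.HasRank m₀) {I : Set (Sym2 ℕ)} (hI : M.M.Indep I)
    (hc : (m₀ : ℕ∞) ≤ I.encard) : M.M.closure I = M.M.E := by
  have hB : M.M.IsBase I := hI.isBase_of_eRk_ge (indep_finite h hI) (by
    rw [eRank_eq h, hI.eRk_eq_encard]; exact hc)
  exact hB.closure_eq

/-- A permutation fixing `u` and moving the small vertices away. -/
lemma exists_shift (k u : ℕ) : ∃ σ : Equiv.Perm ℕ, (u < k → σ u = u) ∧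
    ∀ v, v < k → v ≠ u → k ≤ σ v := by
  let f : ℕ → ℕ := fun i => if i < k ∧ i ≠ u then i + k else
    if k ≤ i ∧ i < 2 * k ∧ i ≠ u + k then i - k else i
  have hf : Function.Involutive f := by
    intro i
    simp only [f]
    split_ifs <;> omega
  refine ⟨hf.toPerm, ?_, ?_⟩
  · intro h
    simp only [Function.Involutive.coe_toPerm, f]
    split_ifs <;> omega
  · intro v h1 h2
    simp only [Function.Involutive.coe_toPerm, f]
    split_ifs <;> omega

/-- Edges avoiding the first `k` vertices span. -/
lemma clique_spans (h : M.HasRank m₀) {X : Set (Sym2 ℕ)} (k : ℕ)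
    (hX : ∀ e : Sym2 ℕ, ¬ e.IsDiag → (∀ v ∈ e, k ≤ v) → e ∈ M.M.closure X) :
    M.M.E ⊆ M.M.closure X := by
  obtain ⟨B, hB⟩ := M.M.exists_isBase
  have hBf := indep_finite h hB.indep
  obtain ⟨n, hn⟩ := bdd hBf
  obtain ⟨σ, -, hσ⟩ := exists_shift (max n k) (max n k)
  have hi : M.M.Indep (Sym2.map σ '' B) := M.invariant σ B hB.indep
  have hsub : Sym2.map σ '' B ⊆ M.M.closure X := by
    rintro _ ⟨e, he, rfl⟩
    apply hX
    · rw [isDiag_map]; exact (mem_E M).1 (hB.subset_ground he)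
    · intro v hv
      rw [Sym2.mem_map] at hv
      obtain ⟨w, hw, rfl⟩ := hv
      have hwn := hn w ⟨e, he, hw⟩
      exact le_trans (le_max_right n k) (hσ w (lt_of_lt_of_le hwn (le_max_left n k))
        (ne_of_lt (lt_of_lt_of_le hwn (le_max_left n k))))
  have hc := closure_of_indep h hi (by
    rw [(Sym2.map.injective σ.injective).encard_image, hB.encard_eq_eRank, eRank_eq h])
  rw [← hc]
  exact M.M.closure_subset_closure_of_subset_closure hsub

end BW
namespace BW

open Set

/-- The full star at `u`. -/
def star (u : ℕ) : Set (Sym2 ℕ) := {e | ¬ e.IsDiag ∧ u ∈ e}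

variable {M : GraphMatroidFamily} {m₀ : ℕ}

lemma fan {F : Set (Sym2 ℕ)} {u x : ℕ} (hux : u ≠ x) (hx : x ∉ eSupp F)
    (he : s(u, x) ∈ M.M.closure F) {w : ℕ} (hw : w ∉ eSupp F) (hwu : w ≠ u) :
    s(u, w) ∈ M.M.closure F := by
  have h := closure_map M (Equiv.swap x w) he
  rw [map_fix] at h
  · rw [Sym2.map_mk, Equiv.swap_apply_left,
      Equiv.swap_apply_of_ne_of_ne hux hwu.symm] at h
    exact h
  · intro v hv
    apply Equiv.swap_apply_of_ne_of_ne
    · rintro rfl; exact hx hv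
    · rintro rfl; exact hw hv

lemma star_subset (u : ℕ) : star u ⊆ M.M.E := fun _ he => (mem_E M).2 he.1

lemma star_cases {u : ℕ} {e : Sym2 ℕ} (he : e ∈ star u) : ∃ x, x ≠ u ∧ e = s(u, x) := by
  obtain ⟨hd, hu⟩ := he
  obtain ⟨x, rfl⟩ := hu
  refine ⟨x, ?_, rfl⟩
  rintro rfl
  exact hd (by simp)

lemma star_spans {u : ℕ} {T : Set (Sym2 ℕ)} (hT : T ⊆ star u) (hd : ¬ M.M.Indep T) :
    star u ⊆ M.M.closure T := by
  have hdep : M.M.Dep T := ⟨hd, hT.trans (star_subset u)⟩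
  obtain ⟨C, hCT, hC⟩ := hdep.exists_isCircuit_subset
  obtain ⟨f, hf⟩ := hC.nonempty
  obtain ⟨x, hxu, rfl⟩ := star_cases (hT (hCT hf))
  have hcl := hC.mem_closure_sdiff_singleton_of_mem hf
  have hx : x ∉ eSupp (C \ {s(u, x)}) := by
    rintro ⟨e, he, hxe⟩
    obtain ⟨y, hyu, rfl⟩ := star_cases (hT (hCT he.1))
    rw [Sym2.mem_iff] at hxe
    rcases hxe with h | h
    · exact hxu h
    · subst h; exact he.2 rfl
  intro e he
  apply M.M.closure_subset_closure (sdiff_subset.trans hCT : C \ {s(u, x)} ⊆ T)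
  obtain ⟨w, hwu, rfl⟩ := star_cases he
  by_cases hw : w ∈ eSupp (C \ {s(u, x)})
  · obtain ⟨e, he', hwe⟩ := hw
    obtain ⟨y, hyu, rfl⟩ := star_cases (hT (hCT he'.1))
    rw [Sym2.mem_iff] at hwe
    rcases hwe with h | h
    · exact absurd h hwu
    · subst h; exact M.M.mem_closure_of_mem' he' (star_subset u he)
  · exact fan hxu.symm hx hcl hw hwu

/-- All independent sets in a star have fewer than `m₀` elements. -/
def SmallStar (M : GraphMatroidFamily) (m₀ : ℕ) : Prop :=
  ∀ u : ℕ, ∀ I ⊆ star u, M.M.Indep I → I.encard < m₀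

lemma smallStar_of_circuit (h : M.HasRank m₀) {C : Set (Sym2 ℕ)} (hC : M.IsCircuit C)
    (hc : C.ncard ≤ m₀) (hd : minDeg C = 1) : SmallStar M m₀ := by
  obtain ⟨⟨hfin, hdiag⟩, hni, hind⟩ := hC
  have hmem : 1 ∈ {k : ℕ | ∃ v ∈ eSupp C, deg C v = k} := by
    rw [← hd]
    apply Nat.sInf_mem
    by_contra hcon
    rw [not_nonempty_iff_eq_empty] at hcon
    rw [minDeg, hcon] at hd
    simp at hd
  obtain ⟨v, -, hv⟩ := hmem
  rw [deg, ncard_eq_one] at hv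
  obtain ⟨e, he⟩ := hv
  have heC : e ∈ C ∧ v ∈ e := by
    have : e ∈ ({e} : Set (Sym2 ℕ)) := rfl
    rw [← he] at this; exact this
  obtain ⟨u, hue⟩ : ∃ u, e = s(u, v) := by
    obtain ⟨x, hx⟩ := heC.2
    exact ⟨x, by rw [hx, Sym2.eq_swap]⟩
  subst hue
  have huv : u ≠ v := by
    intro h1
    exact hdiag _ heC.1 (by simp [h1])
  set F := C \ {s(u, v)} with hF
  have hvF : v ∉ eSupp F := by
    rintro ⟨f, hf, hvf⟩
    have : f ∈ ({s(u, v)} : Set (Sym2 ℕ)) := by rw [← he]; exact ⟨hf.1, hvf⟩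
    exact hf.2 this
  have hFi : M.M.Indep F := hind _ heC.1
  have hcl : s(u, v) ∈ M.M.closure F := by
    rw [hFi.mem_closure_iff]
    left
    rw [hF, insert_sdiff_singleton, insert_eq_of_mem heC.1]
    exact ⟨hni, fun e he => (mem_E M).2 (hdiag e he)⟩
  have hFc : F.encard < m₀ := by
    have h1 : F.ncard < C.ncard := ncard_sdiff_singleton_lt_of_mem heC.1 hfin
    have hFf : F.Finite := hfin.subset sdiff_subset
    rw [← hFf.cast_ncard_eq, Nat.cast_lt]
    omega
  -- first for this particular `u`
  have key : ∀ I ⊆ star u, M.M.Indep I → I.encard < m₀ := by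
    intro I hI hIi
    obtain ⟨n, hn⟩ := bdd (indep_finite h hIi)
    obtain ⟨k, hk⟩ := bdd (hfin.subset (sdiff_subset : F ⊆ C))
    let K := max (max n k) (u + 1)
    have hnK : n ≤ K := (le_max_left n k).trans (le_max_left _ _)
    have hkK : k ≤ K := (le_max_right n k).trans (le_max_left _ _)
    have huK : u < K := lt_of_lt_of_le (Nat.lt_succ_self u) (le_max_right _ _)
    obtain ⟨σ, hσu, hσ⟩ := exists_shift K u
    have hsub : Sym2.map σ '' I ⊆ M.M.closure F := by
      rintro _ ⟨f, hf, rfl⟩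
      obtain ⟨x, hxu, rfl⟩ := star_cases (hI hf)
      have hxn := hn x ⟨_, hf, by simp⟩
      have hx := hσ x (lt_of_lt_of_le hxn hnK) hxu
      rw [Sym2.map_mk, hσu huK]
      refine fan huv hvF hcl ?_ (by omega)
      intro hcon
      have := hk _ hcon
      omega
    have hi := M.invariant σ I hIi
    have h1 := hi.encard_le_eRk_of_subset hsub
    rw [M.M.eRk_closure_eq, hFi.eRk_eq_encard,
      (Sym2.map.injective σ.injective).encard_image] at h1
    exact lt_of_le_of_lt h1 hFc
  intro u' I hI hIi
  have h1 := key (Sym2.map (Equiv.swap u u') '' I) ?_ (M.invariant _ I hIi)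
  · rwa [(Sym2.map.injective (Equiv.injective _)).encard_image] at h1
  · rintro _ ⟨f, hf, rfl⟩
    refine ⟨by rw [isDiag_map]; exact (hI hf).1, ?_⟩
    rw [Sym2.mem_map]
    exact ⟨u', (hI hf).2, by simp⟩

lemma star_flat (h : M.HasRank m₀) (hs : SmallStar M m₀) (u : ℕ) :
    M.M.closure (star u) ⊆ star u := by
  intro e he
  have heE := (mem_E M).1 (M.M.mem_ground_of_mem_closure he)
  refine ⟨heE, ?_⟩
  by_contra hu
  have hall : M.M.E ⊆ M.M.closure (star u) := by
    intro f hf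
    rw [mem_E] at hf
    by_cases huf : u ∈ f
    · exact M.M.mem_closure_of_mem' (show f ∈ star u from ⟨hf, huf⟩) ((mem_E M).2 hf)
    induction e with | _ x y =>
    induction f with | _ a b =>
    simp only [Sym2.mem_iff, not_or] at hu huf
    simp only [Sym2.mk_isDiag_iff] at heE hf
    obtain ⟨σ, h1, h2, h3⟩ : ∃ σ : Equiv.Perm ℕ, σ u = u ∧ σ x = a ∧ σ y = b := by
      let τ := Equiv.swap x a
      have t1 : τ u = u := Equiv.swap_apply_of_ne_of_ne hu.1 huf.1
      have t2 : τ x = a := Equiv.swap_apply_left x a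
      refine ⟨τ.trans (Equiv.swap (τ y) b), ?_, ?_, ?_⟩
      · rw [Equiv.trans_apply, t1]
        refine Equiv.swap_apply_of_ne_of_ne ?_ huf.2
        rw [← t1]; exact fun hh => hu.2 (τ.injective hh)
      · rw [Equiv.trans_apply, t2]
        refine Equiv.swap_apply_of_ne_of_ne ?_ hf
        rw [← t2]; exact fun hh => heE (τ.injective hh)
      · rw [Equiv.trans_apply, Equiv.swap_apply_left]
    have h4 := closure_map M σ he
    rw [Sym2.map_mk, h2, h3] at h4
    refine M.M.closure_subset_closure ?_ h4
    rintro _ ⟨f, hf, rfl⟩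
    refine ⟨by rw [isDiag_map]; exact hf.1, ?_⟩
    rw [Sym2.mem_map]
    exact ⟨u, hf.2, h1⟩
  obtain ⟨I, hI, hIi, hIc⟩ := base_of_closure h (star_subset u) hall
  have := hs u I hI hIi
  rw [hIc] at this
  exact lt_irrefl _ this

lemma matching_dep_spans (h : M.HasRank m₀) {N : Set (Sym2 ℕ)} (hNE : N ⊆ M.M.E)
    (hN : IsMatching N) (hd : ¬ M.M.Indep N) : M.M.E ⊆ M.M.closure N := by
  have := M.finitary
  obtain ⟨C, hCN, hC⟩ := Matroid.Dep.exists_isCircuit_subset (M := M.M) (X := N) ⟨hd, hNE⟩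
  obtain ⟨f, hf⟩ := hC.nonempty
  have hcl := hC.mem_closure_sdiff_singleton_of_mem hf
  obtain ⟨k, hk⟩ := bdd (hC.finite.subset (sdiff_subset : C \ {f} ⊆ C))
  have hfs : ∀ v ∈ f, v ∉ eSupp (C \ {f}) := by
    rintro v hv ⟨e, he, hve⟩
    exact hN e (hCN he.1) f (hCN hf) he.2 v hve hv
  refine Subset.trans (clique_spans h (X := C \ {f}) k ?_)
    (M.M.closure_subset_closure (sdiff_subset.trans hCN))
  intro e hed hev
  have hes : ∀ v ∈ e, v ∉ eSupp (C \ {f}) := fun v hv hv' =>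
    absurd (hk v hv') (not_lt.2 (hev v hv))
  have hfd := (mem_E M).1 (hC.subset_ground hf)
  clear hev hf
  generalize C \ {f} = F at *
  induction f with | _ x y =>
  induction e with | _ a b =>
  simp only [Sym2.mk_isDiag_iff] at hed hfd
  have hx := hfs x (by simp)
  have hy := hfs y (by simp)
  have ha := hes a (by simp)
  have hb := hes b (by simp)
  obtain ⟨σ, h1, h2, h3⟩ : ∃ σ : Equiv.Perm ℕ, (∀ u ∈ eSupp F, σ u = u) ∧ σ x = a ∧ σ y = b := by
    let τ := Equiv.swap x a
    have t1 : ∀ u ∈ eSupp F, τ u = u := fun u hu => Equiv.swap_apply_of_ne_of_ne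
      (fun hh => hx (hh ▸ hu)) (fun hh => ha (hh ▸ hu))
    have t2 : τ x = a := Equiv.swap_apply_left x a
    refine ⟨τ.trans (Equiv.swap (τ y) b), ?_, ?_, ?_⟩
    · intro u hu
      rw [Equiv.trans_apply, t1 u hu]
      refine Equiv.swap_apply_of_ne_of_ne ?_ (fun hh => hb (hh ▸ hu))
      rw [← t1 u hu]; exact fun hh => hy (τ.injective hh ▸ hu)
    · rw [Equiv.trans_apply, t2]
      refine Equiv.swap_apply_of_ne_of_ne ?_ hed
      rw [← t2]; exact fun hh => hfd (τ.injective hh)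
    · rw [Equiv.trans_apply, Equiv.swap_apply_left]
  have h4 := closure_map M σ hcl
  rw [Sym2.map_mk, h2, h3, map_fix σ h1] at h4
  exact h4

lemma matching_spans (h : M.HasRank m₀) {N : Set (Sym2 ℕ)} (hNE : N ⊆ M.M.E)
    (hN : IsMatching N) (hc : (m₀ : ℕ∞) ≤ N.encard) :
    ∃ I ⊆ N, M.M.Indep I ∧ I.encard = m₀ := by
  by_cases hi : M.M.Indep N
  · exact ⟨N, Subset.rfl, hi, le_antisymm (indep_le h hi) hc⟩
  · exact base_of_closure h hNE (matching_dep_spans h hNE hN hi)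

/-- A large set of edges contains a big matching or a big star. -/
lemma matching_or_star {U : Set (Sym2 ℕ)} (hU : U.Finite) (m : ℕ)
    (hm : ∀ N ⊆ U, IsMatching N → N.encard < m) (hc : 2 * m * m < U.ncard) :
    ∃ w : ℕ, m ≤ {e ∈ U | w ∈ e}.ncard := by
  classical
  by_contra hcon
  push Not at hcon
  -- a maximal matching
  obtain ⟨N, hN⟩ := (hU.finite_subsets.subset
    (show {N | N ⊆ U ∧ IsMatching N} ⊆ {N | N ⊆ U} from fun _ h => h.1)).exists_maximal
      ⟨∅, empty_subset U, by intro e he; exact absurd he (notMem_empty e)⟩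
  have hNU : N ⊆ U := hN.prop.1
  have hNf := hU.subset hNU
  have hNm := hm N hNU hN.prop.2
  rw [← hNf.cast_ncard_eq, Nat.cast_lt] at hNm
  have hcov : ∀ e ∈ U, ∃ v ∈ eSupp N, v ∈ e := by
    intro e he
    by_contra hno
    push Not at hno
    have heN : e ∉ N := by
      intro heN
      induction e with | _ x y =>
      exact hno x ⟨_, heN, by simp⟩ (by simp)
    have hins : insert e N ∈ {N | N ⊆ U ∧ IsMatching N} := by
      refine ⟨insert_subset he hNU, ?_⟩
      rintro a (rfl | ha) b (rfl | hb) hab v hva hvb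
      · exact hab rfl
      · exact hno v ⟨b, hb, hvb⟩ hva
      · exact hno v ⟨a, ha, hva⟩ hvb
      · exact hN.prop.2 a ha b hb hab v hva hvb
    exact heN (hN.le_of_ge hins (subset_insert e N) (mem_insert e N))
  have hsf := eSupp_finite hNf
  have hs : hsf.toFinset.card ≤ 2 * N.ncard := by
    have : hsf.toFinset ⊆ hNf.toFinset.biUnion (fun e => e.toFinset) := by
      intro v hv
      simp only [Finite.mem_toFinset] at hv
      obtain ⟨e, he, hve⟩ := hv
      simp only [Finset.mem_biUnion, Finite.mem_toFinset, Sym2.mem_toFinset]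
      exact ⟨e, he, hve⟩
    refine (Finset.card_le_card this).trans ((Finset.card_biUnion_le_card_mul _ _ 2 ?_).trans ?_)
    · intro e _
      rw [Sym2.card_toFinset]
      split_ifs <;> omega
    · rw [ncard_eq_toFinset_card N hNf, mul_comm]
  have hUs : hU.toFinset ⊆ hsf.toFinset.biUnion (fun v => hU.toFinset.filter (fun e => v ∈ e)) := by
    intro e he
    simp only [Finite.mem_toFinset] at he
    obtain ⟨v, hv, hve⟩ := hcov e he
    simp only [Finset.mem_biUnion, Finite.mem_toFinset, Finset.mem_filter]
    exact ⟨v, hv, he, hve⟩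
  have h1 := (Finset.card_le_card hUs).trans (Finset.card_biUnion_le_card_mul _ _ m (by
    intro v _
    have := hcon v
    have h2 : {e ∈ U | v ∈ e}.ncard = (hU.toFinset.filter (fun e => v ∈ e)).card := by
      rw [← ncard_coe_finset]
      congr 1
      ext; simp
    omega))
  rw [← ncard_eq_toFinset_card U hU] at h1
  have h2 : hsf.toFinset.card * m ≤ 2 * m * m := Nat.mul_le_mul_right m (by omega)
  omega

lemma deg_of_kconnected {c : ℕ} {E : Set (Sym2 ℕ)} (hE : IsGraph E) (hk : KConnected c E)
    {u : ℕ} (hu : u ∈ eSupp E) : c ≤ {e ∈ E | u ∈ e}.ncard := by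
  classical
  by_contra hcon
  push Not at hcon
  have hDf : {e ∈ E | u ∈ e}.Finite := hE.1.subset (sep_subset _ _)
  have hsf := eSupp_finite hE.1
  let S : Finset ℕ := hsf.toFinset.filter (fun x => s(u, x) ∈ E)
  have hS : S.card < c := by
    refine lt_of_le_of_lt ?_ hcon
    rw [← ncard_coe_finset]
    refine ncard_le_ncard_of_injOn (fun x => s(u, x)) ?_ ?_ hDf
    · intro x hx
      simp only [S, Finset.coe_filter, mem_ofPred_eq] at hx
      exact ⟨hx.2, by simp⟩
    · intro x _ y _ hxy
      exact Sym2.congr_right.1 hxy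
  have hconn := hk.2 S hS
  have huS : u ∉ S := by
    intro hmem
    simp only [S, Finset.mem_filter] at hmem
    exact hE.2 _ hmem.2 (by simp)
  have hcard : 1 < (eSupp E \ ↑S).ncard := by
    have h1 := hk.1
    have h2 := le_ncard_sdiff (↑S : Set ℕ) (eSupp E) S.finite_toSet
    rw [ncard_coe_finset] at h2
    omega
  have hnt : (eSupp E \ ↑S).Nontrivial := (one_lt_ncard (hsf.subset sdiff_subset)).1 hcard |> fun h => by
    obtain ⟨a, ha, b, hb, hab⟩ := h
    exact ⟨a, ha, b, hb, hab⟩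
  have : Nontrivial ↥(eSupp E \ ↑S) := hnt.coe_sort
  obtain ⟨w, hw⟩ := hconn.preconnected.exists_adj_of_nontrivial ⟨u, hu, huS⟩
  simp only [SimpleGraph.comap_adj, SimpleGraph.fromEdgeSet_adj, Function.Embedding.subtype_apply] at hw
  apply w.2.2
  simp only [S, Finset.coe_filter, mem_ofPred_eq, Finite.mem_toFinset]
  exact ⟨w.2.1, hw.1⟩

lemma iso_symm {G H : Set (Sym2 ℕ)} {ψ : Sym2 ℕ → Sym2 ℕ} (h : M.MatroidIso G H ψ) :
    M.MatroidIso H G (Function.invFunOn ψ G) := by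
  have hb := h.1
  have hl := hb.invOn_invFunOn
  refine ⟨hb.symm hl.symm |> fun h => h, ?_⟩
  intro S hS
  have hm : MapsTo (Function.invFunOn ψ G) H G := (hb.symm hl.symm).mapsTo
  rw [h.2 (Function.invFunOn ψ G '' S) ((image_mono hS).trans hm.image_subset), ← image_comp]
  have : (ψ ∘ Function.invFunOn ψ G) '' S = S := by
    have : EqOn (ψ ∘ Function.invFunOn ψ G) id S := fun x hx => hl.2 (hS hx)
    rw [this.image_eq, image_id]
  rw [this]

lemma iso_closure {G H : Set (Sym2 ℕ)} (hH : IsGraph H) {ψ : Sym2 ℕ → Sym2 ℕ}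
    (h : M.MatroidIso G H ψ) {X : Set (Sym2 ℕ)} {e : Sym2 ℕ} (hX : X ⊆ G) (he : e ∈ G)
    (hc : e ∈ M.M.closure X) : ψ e ∈ M.M.closure (ψ '' X) :=
  transfer (fun _ hf => (mem_E M).2 (hH.2 _ (h.1.mapsTo hf))) h.2 hX he hc

lemma iso_closure_symm {G H : Set (Sym2 ℕ)} (hG : IsGraph G) {ψ : Sym2 ℕ → Sym2 ℕ}
    (h : M.MatroidIso G H ψ) {X : Set (Sym2 ℕ)} {e : Sym2 ℕ} (hX : X ⊆ G) (he : e ∈ G)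
    (hc : ψ e ∈ M.M.closure (ψ '' X)) : e ∈ M.M.closure X := by
  have hl := h.1.invOn_invFunOn
  have h1 := iso_closure hG (iso_symm h) ((image_mono hX).trans h.1.mapsTo.image_subset)
    (h.1.mapsTo he) hc
  have e1 : Function.invFunOn ψ G (ψ e) = e := hl.1 he
  have e2 : Function.invFunOn ψ G '' (ψ '' X) = X := by
    rw [← image_comp]
    have : EqOn (Function.invFunOn ψ G ∘ ψ) id X := fun x hx => hl.1 (hX hx)
    rw [this.image_eq, image_id]
  rwa [e1, e2] at h1

lemma dep_of_card (hs : SmallStar M m₀) {u : ℕ} {T : Set (Sym2 ℕ)} (hT : T ⊆ star u)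
    (hf : T.Finite) (hc : m₀ ≤ T.ncard) : ¬ M.M.Indep T := by
  intro hi
  have := hs u T hT hi
  rw [← hf.cast_ncard_eq, Nat.cast_lt] at this
  omega

theorem whitney_of_smallStar (h : M.HasRank m₀) (hs : SmallStar M m₀) : M.Whitney := by
  classical
  refine ⟨2 * m₀ * m₀ + m₀ + 2, ?_⟩
  intro G hG hk H hH ψ hψ
  let D : ℕ → Set (Sym2 ℕ) := fun u => {e ∈ G | u ∈ e}
  have hDG : ∀ u, D u ⊆ G := fun u => sep_subset _ _
  have hDf : ∀ u, (D u).Finite := fun u => hG.1.subset (hDG u)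
  have hDs : ∀ u, D u ⊆ star u := fun u e he => ⟨hG.2 e he.1, he.2⟩
  have hDc : ∀ u ∈ eSupp G, 2 * m₀ * m₀ + m₀ + 2 ≤ (D u).ncard := fun u hu =>
    deg_of_kconnected hG hk hu
  have key : ∀ u ∈ eSupp G, ∃ w, ψ '' D u ⊆ star w := by
    intro u hu
    have hUH : ψ '' D u ⊆ H := (image_mono (hDG u)).trans hψ.1.mapsTo.image_subset
    have hinj : InjOn ψ (D u) := hψ.1.injOn.mono (hDG u)
    have hUc : (ψ '' D u).ncard = (D u).ncard := hinj.ncard_image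
    have hUi : ∀ I ⊆ ψ '' D u, M.M.Indep I → I.encard < m₀ := by
      intro I hI hIi
      obtain ⟨J, hJ, rfl⟩ := subset_image_iff.1 hI
      rw [(hinj.mono hJ).encard_image]
      exact hs u J (hJ.trans (hDs u)) ((hψ.2 J (hJ.trans (hDG u))).2 hIi)
    have hHE : H ⊆ M.M.E := fun e he => (mem_E M).2 (hH.2 e he)
    obtain ⟨w, hw⟩ := matching_or_star ((hDf u).image ψ) m₀ (by
      intro N hN hNm
      by_contra hcon
      push Not at hcon
      obtain ⟨I, hI, hIi, hIc⟩ := matching_spans h (hN.trans (hUH.trans hHE)) hNm hcon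
      have := hUi I (hI.trans hN) hIi
      rw [hIc] at this
      exact lt_irrefl _ this) (by rw [hUc]; have := hDc u hu; omega)
    refine ⟨w, ?_⟩
    set T := {e ∈ ψ '' D u | w ∈ e} with hT
    have hTs : T ⊆ star w := fun e he => ⟨hH.2 e (hUH he.1), he.2⟩
    have hTd : ¬ M.M.Indep T :=
      dep_of_card hs hTs (((hDf u).image ψ).subset (sep_subset _ _)) hw
    obtain ⟨T', hT', hTT'⟩ := subset_image_iff.1 (sep_subset _ _ : T ⊆ ψ '' D u)
    have hT'd : ¬ M.M.Indep T' := by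
      intro hi
      have h1 := (hψ.2 T' (hT'.trans (hDG u))).1 hi
      rw [hTT'] at h1
      exact hTd h1
    have hsp := star_spans (hT'.trans (hDs u)) hT'd
    rintro _ ⟨g, hg, rfl⟩
    have h1 := iso_closure hH hψ (hT'.trans (hDG u)) (hDG u hg) (hsp (hDs u hg))
    rw [hTT'] at h1
    exact star_flat h hs w (M.M.closure_subset_closure hTs h1)
  choose! φ hφ using key
  have hinj : InjOn φ (eSupp G) := by
    intro u hu v hv huv
    by_contra hne
    have hdu : ¬ M.M.Indep (ψ '' D u) := by
      intro hi
      exact dep_of_card hs (hDs u) (hDf u) (by have := hDc u hu; omega) ((hψ.2 _ (hDG u)).2 hi)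
    have hsp := star_spans (hφ u hu) hdu
    have hsub : D v ⊆ star u := by
      intro e he
      have h1 : ψ e ∈ M.M.closure (ψ '' D u) := by
        apply hsp
        rw [huv]
        exact hφ v hv (mem_image_of_mem ψ he)
      have h2 := iso_closure_symm hG hψ (hDG u) (hDG v he) h1
      exact star_flat h hs u (M.M.closure_subset_closure (hDs u) h2)
    have hsing : D v ⊆ {s(u, v)} := by
      intro e he
      exact (Sym2.mem_and_mem_iff hne).1 ⟨(hsub he).2, he.2⟩
    have h1 := ncard_le_ncard hsing
    rw [ncard_singleton] at h1
    have := hDc v hv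
    omega
  have hmap : ∀ e ∈ G, ψ e = Sym2.map φ e := by
    intro e he
    induction e with | _ x y =>
    have hx : x ∈ eSupp G := ⟨_, he, by simp⟩
    have hy : y ∈ eSupp G := ⟨_, he, by simp⟩
    have hxy : x ≠ y := by
      have := hG.2 _ he
      simpa using this
    have h1 := hφ x hx (mem_image_of_mem ψ (show s(x, y) ∈ D x from ⟨he, by simp⟩))
    have h2 := hφ y hy (mem_image_of_mem ψ (show s(x, y) ∈ D y from ⟨he, by simp⟩))
    exact (Sym2.mem_and_mem_iff (fun hh => hxy (hinj hx hy hh))).1 ⟨h1.2, h2.2⟩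
  refine ⟨φ, ⟨?_, hinj, ?_⟩, hmap⟩
  · rintro u ⟨e, he, hue⟩
    refine ⟨ψ e, hψ.1.mapsTo he, ?_⟩
    rw [hmap e he, Sym2.mem_map]
    exact ⟨u, hue, rfl⟩
  · rintro w ⟨f, hf, hwf⟩
    obtain ⟨e, he, rfl⟩ := hψ.1.surjOn hf
    rw [hmap e he, Sym2.mem_map] at hwf
    obtain ⟨u, hu, rfl⟩ := hwf
    exact ⟨u, ⟨e, he, hu⟩, rfl⟩

end BW
namespace BW

open Set

/-- The heap-ordered `b`-ary tree on `{0, …, N-1}` together with a clique on `{K, …, N-1}`. -/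
def heap (b K N : ℕ) : Set (Sym2 ℕ) :=
  {e | ∃ x y, x < y ∧ y < N ∧ e = s(x, y) ∧ (K ≤ x ∨ (b * x < y ∧ y ≤ b * x + b))}

lemma heap_mem {b K N x y : ℕ} (hxy : x < y) : s(x, y) ∈ heap b K N ↔
    y < N ∧ (K ≤ x ∨ (b * x < y ∧ y ≤ b * x + b)) := by
  constructor
  · rintro ⟨x', y', h1, h2, h3, h4⟩
    rw [Sym2.eq_iff] at h3
    rcases h3 with ⟨rfl, rfl⟩ | ⟨rfl, rfl⟩
    · exact ⟨h2, h4⟩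
    · omega
  · rintro ⟨h1, h2⟩
    exact ⟨x, y, hxy, h1, rfl, h2⟩

lemma heap_lt {b K N v : ℕ} {e : Sym2 ℕ} (he : e ∈ heap b K N) (hv : v ∈ e) : v < N := by
  obtain ⟨x, y, h1, h2, rfl, -⟩ := he
  rw [Sym2.mem_iff] at hv
  omega

lemma heap_graph (b K N : ℕ) : IsGraph (heap b K N) := by
  have hd : ∀ e ∈ heap b K N, ¬ e.IsDiag := by
    rintro e ⟨x, y, h1, h2, rfl, h3⟩
    rw [Sym2.mk_isDiag_iff]
    omega
  refine ⟨(cliqueN_finite N).subset fun e he => ⟨hd e he, fun v hv => heap_lt he hv⟩, hd⟩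

lemma child_lt {b x y : ℕ} (hb : 1 ≤ b) (h : b * x < y) : x < y :=
  lt_of_le_of_lt (Nat.le_mul_of_pos_left x hb) h

lemma parent {b y : ℕ} (hb : 1 ≤ b) (hy : 1 ≤ y) :
    b * ((y - 1) / b) < y ∧ y ≤ b * ((y - 1) / b) + b := by
  have h1 := Nat.div_add_mod (y - 1) b
  have h2 := Nat.mod_lt (y - 1) hb
  omega

lemma parent_eq {b x y : ℕ} (h1 : b * x < y) (h2 : y ≤ b * x + b) : (y - 1) / b = x := by
  apply Nat.div_eq_of_lt_le
  · rw [mul_comm]; omega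
  · rw [add_mul, mul_comm x b]; omega

lemma heap_supp {b K N : ℕ} (hb : 1 ≤ b) (hN : b * K + b < N) :
    eSupp (heap b K N) = Set.Iio N := by
  ext v
  constructor
  · rintro ⟨e, he, hv⟩; exact heap_lt he hv
  · intro hv
    rw [mem_Iio] at hv
    rcases Nat.eq_zero_or_pos v with rfl | hpos
    · exact ⟨s(0, 1), (heap_mem (by omega)).2 ⟨by omega, Or.inr (by omega)⟩, by simp⟩
    · have hp := parent hb hpos
      exact ⟨s((v - 1) / b, v), (heap_mem (child_lt hb hp.1)).2 ⟨hv, Or.inr hp⟩, by simp⟩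

lemma heap_connected {c b K N : ℕ} (hb : b = c + 3) (hN : b * K + b < N) :
    KConnected c (heap b K N) := by
  classical
  have hsupp := heap_supp (K := K) (b := b) (N := N) (by omega) hN
  have hKb : K ≤ b * K := Nat.le_mul_of_pos_left K (by omega)
  refine ⟨?_, ?_⟩
  · rw [hsupp, ← Finset.coe_Iio, ncard_coe_finset, Nat.card_Iio]
    omega
  intro S hS
  rw [hsupp]
  set V : Set ℕ := Set.Iio N \ ↑S with hV
  set Γ := (SimpleGraph.fromEdgeSet (heap b K N)).induce V with hΓ
  have hadj : ∀ (x y : ℕ) (hx : x ∈ V) (hy : y ∈ V), x < y →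
      (K ≤ x ∨ (b * x < y ∧ y ≤ b * x + b)) → Γ.Adj ⟨x, hx⟩ ⟨y, hy⟩ := by
    intro x y hx hy hxy h
    simp only [hΓ, SimpleGraph.comap_adj, SimpleGraph.fromEdgeSet_adj,
      Function.Embedding.subtype_apply]
    exact ⟨(heap_mem hxy).2 ⟨hy.1, h⟩, by omega⟩
  have hclique : ∀ (x y : ℕ) (hx : x ∈ V) (hy : y ∈ V), K ≤ x → K ≤ y →
      Γ.Reachable ⟨x, hx⟩ ⟨y, hy⟩ := by
    intro x y hx hy h1 h2
    rcases lt_trichotomy x y with h | h | h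
    · exact (hadj x y hx hy h (Or.inl h1)).reachable
    · subst h; exact SimpleGraph.Reachable.refl _
    · exact (hadj y x hy hx h (Or.inl h2)).reachable.symm
  -- a clique vertex
  obtain ⟨z, hz, hzS⟩ : ∃ z ∈ Finset.Ico K N, z ∉ S := by
    apply Finset.exists_mem_notMem_of_card_lt_card
    rw [Nat.card_Ico]
    omega
  rw [Finset.mem_Ico] at hz
  have hzV : z ∈ V := ⟨hz.2, hzS⟩
  have hreach : ∀ n (hn : n ∈ V), ∃ x, ∃ hx : x ∈ V, K ≤ x ∧ Γ.Reachable ⟨n, hn⟩ ⟨x, hx⟩ := by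
    intro n hn
    by_contra hcon
    push Not at hcon
    let A : Finset ℕ := (Finset.range N).filter
      (fun x => ∃ hx : x ∈ V, Γ.Reachable ⟨n, hn⟩ ⟨x, hx⟩)
    have hA : ∀ x, x ∈ A ↔ ∃ hx : x ∈ V, Γ.Reachable ⟨n, hn⟩ ⟨x, hx⟩ := by
      intro x
      simp only [A, Finset.mem_filter, Finset.mem_range]
      exact ⟨fun h => h.2, fun h => ⟨h.1.1, h⟩⟩
    have hnA : n ∈ A := (hA n).2 ⟨hn, SimpleGraph.Reachable.refl _⟩
    have hAK : ∀ x ∈ A, x < K := by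
      intro x hx
      obtain ⟨hxV, hr⟩ := (hA x).1 hx
      by_contra hc
      exact hcon x hxV (by omega) hr
    have hcard : (A ×ˢ Finset.range b).card ≤ (A ∪ S).card := by
      refine Finset.card_le_card_of_injOn (fun p => b * p.1 + p.2 + 1) ?_ ?_
      · rintro ⟨x, i⟩ hp
        simp only [Finset.coe_product, mem_prod, Finset.mem_coe, Finset.mem_range] at hp
        obtain ⟨hx, hi⟩ := hp
        have hxK := hAK x hx
        have h1 : b * x ≤ b * K := Nat.mul_le_mul_left b hxK.le
        simp only [Finset.coe_union, mem_union, Finset.mem_coe]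
        by_cases hyS : b * x + i + 1 ∈ S
        · exact Or.inr hyS
        left
        obtain ⟨hxV, hr⟩ := (hA x).1 hx
        have hyV : b * x + i + 1 ∈ V := ⟨by rw [mem_Iio]; omega, hyS⟩
        refine (hA _).2 ⟨hyV, hr.trans (hadj x _ hxV hyV (child_lt (b := b) (by omega) (by omega))
          (Or.inr ⟨by omega, by omega⟩)).reachable⟩
      · rintro ⟨x, i⟩ hp ⟨x', i'⟩ hp' heq
        simp only [Finset.coe_product, mem_prod, Finset.mem_coe, Finset.mem_range] at hp hp'
        simp only at heq
        have e1 := parent_eq (b := b) (x := x) (y := b * x + i + 1) (by omega) (by omega)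
        have e2 := parent_eq (b := b) (x := x') (y := b * x' + i' + 1) (by omega) (by omega)
        rw [heq, e2] at e1
        subst e1
        simp only [Prod.mk.injEq, true_and]
        omega
    rw [Finset.card_product, Finset.card_range, hb] at hcard
    have h2 := Finset.card_union_le A S
    have h3 : 1 ≤ A.card := Finset.card_pos.2 ⟨n, hnA⟩
    have h4 : c ≤ A.card * c := Nat.le_mul_of_pos_left c h3
    have h5 : A.card * (c + 3) = A.card * c + A.card * 3 := by ring
    omega
  rw [SimpleGraph.connected_iff]
  refine ⟨?_, ⟨⟨z, hzV⟩⟩⟩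
  rintro ⟨x, hx⟩ ⟨y, hy⟩
  obtain ⟨x', hx', hxK, hxr⟩ := hreach x hx
  obtain ⟨y', hy', hyK, hyr⟩ := hreach y hy
  exact hxr.trans ((hclique x' y' hx' hy' hxK hyK).trans hyr.symm)

/-- Upper bound for the labels at depth `j + 1` of the tree. -/
def lvl (b : ℕ) : ℕ → ℕ
  | 0 => 1
  | j + 1 => b * lvl b j + b

lemma lvl_mono {b : ℕ} (hb : 1 ≤ b) : Monotone (lvl b) := by
  apply monotone_nat_of_le_succ
  intro n
  have := Nat.le_mul_of_pos_left (lvl b n) hb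
  simp only [lvl]
  omega

lemma tree_escape {b K N m : ℕ} (hb : 1 ≤ b) (hK : lvl b m < K) {C : Set (Sym2 ℕ)}
    (hCG : C ⊆ heap b K N) (hdeg : ∀ v ∈ eSupp C, 2 ≤ deg C v) (he : s(0, 1) ∈ C) :
    m < C.ncard := by
  classical
  have hCf : C.Finite := (heap_graph b K N).1.subset hCG
  let X : Set ℕ := {y | 1 ≤ y ∧ s((y - 1) / b, y) ∈ C}
  have hstep : ∀ y ∈ X, y < K → ∃ z ∈ X, y < z ∧ z ≤ b * y + b := by
    rintro y ⟨hy1, hyC⟩ hyK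
    have h2 := hdeg y ⟨_, hyC, by simp⟩
    have hf : {e ∈ C | y ∈ e}.Finite := hCf.subset (sep_subset _ _)
    obtain ⟨g, hg, hne⟩ := exists_ne_of_one_lt_ncard (show 1 < {e ∈ C | y ∈ e}.ncard from h2)
      s((y - 1) / b, y)
    obtain ⟨hgC, hyg⟩ := hg
    obtain ⟨x', y', h3, h4, rfl, h5⟩ := hCG hgC
    rw [Sym2.mem_iff] at hyg
    rcases hyg with rfl | rfl
    · have h6 : b * y < y' ∧ y' ≤ b * y + b := by omega
      refine ⟨y', ⟨by omega, ?_⟩, h3, h6.2⟩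
      rw [parent_eq h6.1 h6.2]
      exact hgC
    · have h6 : b * x' < y ∧ y ≤ b * x' + b := by omega
      rw [parent_eq h6.1 h6.2] at hne
      exact absurd rfl hne
  have hT : ∀ j, j ≤ m → ∃ T : Finset ℕ, ↑T ⊆ X ∧ T.card = j + 1 ∧
      ∃ t ∈ T, (∀ y ∈ T, y ≤ t) ∧ t ≤ lvl b j := by
    intro j
    induction j with
    | zero =>
      intro _
      refine ⟨{1}, ?_, by simp, 1, by simp, by simp, by simp [lvl]⟩
      intro y hy
      simp only [Finset.coe_singleton, mem_singleton_iff] at hy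
      subst hy
      refine ⟨le_refl 1, ?_⟩
      simpa using he
    | succ j ih =>
      intro hj
      obtain ⟨T, hTX, hTc, t, htT, hmax, htl⟩ := ih (by omega)
      have hl : lvl b j ≤ lvl b m := lvl_mono hb (by omega)
      obtain ⟨z, hzX, htz, hz⟩ := hstep t (hTX htT) (by omega)
      have hzT : z ∉ T := fun h => by have := hmax z h; omega
      refine ⟨insert z T, ?_, ?_, z, Finset.mem_insert_self z T, ?_, ?_⟩
      · rw [Finset.coe_insert]; exact insert_subset hzX hTX
      · rw [Finset.card_insert_of_notMem hzT, hTc]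
      · intro y hy
        rw [Finset.mem_insert] at hy
        rcases hy with rfl | hy
        · exact le_refl _
        · have := hmax y hy; omega
      · have := Nat.mul_le_mul_left b htl
        simp only [lvl]
        omega
  obtain ⟨T, hTX, hTc, -⟩ := hT m le_rfl
  have h1 : (↑T : Set ℕ).ncard ≤ C.ncard := by
    refine ncard_le_ncard_of_injOn (fun y => s((y - 1) / b, y)) ?_ ?_ hCf
    · intro y hy; exact (hTX hy).2
    · intro y hy y' hy' heq
      have p1 := child_lt hb (parent hb (hTX hy).1).1
      have p2 := child_lt hb (parent hb (hTX hy').1).1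
      simp only [Sym2.eq_iff] at heq
      omega
  rw [ncard_coe_finset] at h1
  omega

variable {M : GraphMatroidFamily} {m₀ : ℕ}

lemma not_indep_iff (h : M.HasRank m₀) {X : Set (Sym2 ℕ)} (hX : IsGraph X) :
    ¬ M.M.Indep X ↔ m₀ < X.ncard ∨ ∃ C ⊆ X, M.IsCircuit C ∧ C.ncard ≤ m₀ := by
  constructor
  · intro hni
    by_cases hc : m₀ < X.ncard
    · exact Or.inl hc
    right
    obtain ⟨C, hCX, hC⟩ := Matroid.Dep.exists_isCircuit_subset (M := M.M) (X := X)
      ⟨hni, fun e he => (mem_E M).2 (hX.2 e he)⟩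
    have := ncard_le_ncard hCX hX.1
    refine ⟨C, hCX, ⟨⟨hX.1.subset hCX, fun e he => hX.2 e (hCX he)⟩, hC.not_indep,
      fun e he => hC.sdiff_singleton_indep he⟩, by omega⟩
  · rintro (hc | ⟨C, hCX, hC, -⟩) hi
    · have := indep_le h hi
      rw [← hX.1.cast_ncard_eq, Nat.cast_le] at this
      omega
    · exact hC.2.1 (hi.subset hCX)

theorem not_whitney (h : M.HasRank m₀)
    (hno : ¬ ∃ C : Set (Sym2 ℕ), M.IsCircuit C ∧ C.ncard ≤ m₀ ∧ minDeg C = 1) :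
    ¬ M.Whitney := by
  classical
  have hdeg : ∀ C, M.IsCircuit C → C.ncard ≤ m₀ → ∀ v ∈ eSupp C, 2 ≤ deg C v := by
    intro C hC hc v hv
    have hpos : ∀ w ∈ eSupp C, 1 ≤ deg C w := by
      rintro w ⟨e, he, hwe⟩
      have hf : {e ∈ C | w ∈ e}.Finite := hC.1.1.subset (sep_subset _ _)
      exact (ncard_pos hf).2 ⟨e, he, hwe⟩
    by_contra hlt
    have h1 := hpos v hv
    apply hno
    refine ⟨C, hC, hc, ?_⟩
    have hm : 1 ∈ {k : ℕ | ∃ v ∈ eSupp C, deg C v = k} := ⟨v, hv, by omega⟩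
    apply le_antisymm (Nat.sInf_le hm)
    obtain ⟨w, hw, hwd⟩ := Nat.sInf_mem ⟨1, hm⟩
    exact (hpos w hw).trans hwd.le
  rintro ⟨c, hW⟩
  obtain ⟨b, hb⟩ : ∃ b, b = c + 3 := ⟨_, rfl⟩
  have hb1 : 1 ≤ b := by omega
  obtain ⟨K, hK⟩ : ∃ K, K = lvl b m₀ + 1 := ⟨_, rfl⟩
  obtain ⟨N, hN⟩ : ∃ N, N = b * K + b + 1 := ⟨_, rfl⟩
  set G := heap b K N with hG
  have hGg : IsGraph G := heap_graph b K N
  have hrec := hW G hGg (heap_connected hb (by omega))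
  let ψ : Sym2 ℕ → Sym2 ℕ := fun g => if g = s(0, 1) then s(N, N + 1) else g
  have hψ1 : ψ s(0, 1) = s(N, N + 1) := by simp [ψ]
  have hψ2 : ∀ g, g ≠ s(0, 1) → ψ g = g := by
    intro g hg; simp [ψ, hg]
  have hnew : s(N, N + 1) ∉ G := fun hh => by
    have := heap_lt hh (show N ∈ s(N, N + 1) by simp)
    omega
  have hinj : InjOn ψ G := by
    intro x hx y hy hxy
    by_cases h1 : x = s(0, 1) <;> by_cases h2 : y = s(0, 1)
    · rw [h1, h2]
    · rw [h1, hψ1, hψ2 y h2] at hxy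
      exact absurd (hxy ▸ hy) hnew
    · rw [h2, hψ1, hψ2 x h1] at hxy
      exact absurd (hxy ▸ hx) hnew
    · rwa [hψ2 x h1, hψ2 y h2] at hxy
  have hHg : ∀ S ⊆ G, IsGraph (ψ '' S) := by
    intro S hS
    refine ⟨(hGg.1.subset hS).image ψ, ?_⟩
    rintro _ ⟨g, hg, rfl⟩
    by_cases h1 : g = s(0, 1)
    · rw [h1, hψ1]; simp
    · rw [hψ2 g h1]; exact hGg.2 g (hS hg)
  have hiso : M.MatroidIso G (ψ '' G) ψ := by
    refine ⟨hinj.bijOn_image, ?_⟩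
    intro S hS
    have hSg : IsGraph S := ⟨hGg.1.subset hS, fun e he => hGg.2 e (hS he)⟩
    apply not_iff_not.1
    refine (not_indep_iff h hSg).trans (Iff.trans ?_ (not_indep_iff h (hHg S hS)).symm)
    rw [(hinj.mono hS).ncard_image]
    refine or_congr Iff.rfl ⟨?_, ?_⟩
    · rintro ⟨C, hCS, hC, hc⟩
      refine ⟨C, ?_, hC, hc⟩
      have h01 : s(0, 1) ∉ C := by
        intro hmem
        have := tree_escape hb1 (by omega : lvl b m₀ < K) (hCS.trans hS) (hdeg C hC hc) hmem
        omega
      intro g hg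
      refine ⟨g, hCS hg, hψ2 g ?_⟩
      rintro rfl
      exact h01 hg
    · rintro ⟨C, hCS, hC, hc⟩
      refine ⟨C, ?_, hC, hc⟩
      have hnC : s(N, N + 1) ∉ C := by
        intro hmem
        have h2 := hdeg C hC hc N ⟨_, hmem, by simp⟩
        have hsub : {e ∈ C | N ∈ e} ⊆ {s(N, N + 1)} := by
          rintro e ⟨he, hNe⟩
          obtain ⟨g, hg, rfl⟩ := hCS he
          by_cases h1 : g = s(0, 1)
          · rw [h1, hψ1]; rfl
          · rw [hψ2 g h1] at hNe
            have := heap_lt (hS hg) hNe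
            omega
        have h3 := ncard_le_ncard hsub
        rw [ncard_singleton] at h3
        rw [deg] at h2
        omega
      intro e he
      obtain ⟨g, hg, rfl⟩ := hCS he
      by_cases h1 : g = s(0, 1)
      · rw [h1, hψ1] at he; exact absurd he hnC
      · rw [hψ2 g h1]; exact hg
  obtain ⟨φ, -, hφ⟩ := hrec _ (hHg G Subset.rfl) ψ hiso
  have hm : ∀ i, 1 ≤ i → i ≤ 3 → s(0, i) ∈ G := fun i h1 h2 =>
    (heap_mem (by omega)).2 ⟨by omega, Or.inr (by omega)⟩
  have e1 := hφ _ (hm 1 (by omega) (by omega))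
  have e2 := hφ _ (hm 2 (by omega) (by omega))
  have e3 := hφ _ (hm 3 (by omega) (by omega))
  rw [hψ1, Sym2.map_mk, Sym2.eq_iff] at e1
  rw [hψ2 _ (by simp), Sym2.map_mk, Sym2.eq_iff] at e2 e3
  omega

end BW

/-- A bounded graph matroid family `M` (of rank `m₀ = r(M)`) has the
Whitney property if and only if there is a small `M`-circuit (one with at most `m₀`
edges) with minimum degree one. -/
theorem bounded_whitney_iff (M : GraphMatroidFamily) (m₀ : ℕ)
    (hb : M.Bounded) (hm₀ : M.HasRank m₀) :
    M.Whitney ↔ ∃ C : Set (Sym2 ℕ), M.IsCircuit C ∧ C.ncard ≤ m₀ ∧ minDeg C = 1 := by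
  constructor
  · intro hW
    by_contra hno
    exact BW.not_whitney hm₀ hno hW
  · rintro ⟨C, hC, hc, hd⟩
    exact BW.whitney_of_smallStar hm₀ (BW.smallStar_of_circuit hm₀ hC hc hd)
end

section
/- Let M be the union of graph matroid families M₁, …, M_k. If each of M₁, …, M_k has the Lovász-Yemini property, then so does M. -/
namespace LYU
open Finset Classical

lemma order_sum (ρ : Finset ℕ → ℕ) (B : Finset ℕ) (f : ℕ → ℤ) (hf : Function.Injective f)
    (g : ℕ → ℕ) (R : Finset ℕ)
    (h : ∀ v ∈ R, ρ (B ∪ R.filter (fun u => f u < f v)) + g v ≤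
      ρ (insert v (B ∪ R.filter (fun u => f u < f v)))) :
    ρ B + ∑ v ∈ R, g v ≤ ρ (B ∪ R) := by
  induction R using Finset.induction_on_max_value f with
  | empty => simp
  | insert a s ha hmax ih =>
    have h1 : ∀ v ∈ s, (insert a s).filter (fun u => f u < f v) = s.filter (fun u => f u < f v) := by
      intro v hv
      rw [Finset.filter_insert, if_neg (not_lt.mpr (hmax v hv))]
    have h2 : (insert a s).filter (fun u => f u < f a) = s := by
      rw [Finset.filter_insert, if_neg (lt_irrefl _)]
      apply Finset.filter_true_of_mem
      intro x hx
      apply lt_of_le_of_ne (hmax x hx)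
      intro he
      exact ha (hf he ▸ hx)
    have h3 := ih (fun v hv => by
      have := h v (Finset.mem_insert_of_mem hv)
      rwa [h1 v hv] at this)
    have h4 := h a (Finset.mem_insert_self _ _)
    rw [h2] at h4
    rw [Finset.sum_insert ha, Finset.union_insert]
    omega

/-- small multiply dominating set -/
lemma exists_dom (adj : ℕ → ℕ → Prop) (hs : ∀ x y, adj x y → adj y x)
    (W : Finset ℕ) (s l δ : ℕ)
    (hdeg : ∀ v ∈ W, δ + s ≤ (W.filter (adj v)).card) :
    ∃ A ⊆ W, l * A.card ≤ s * W.card ∧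
      ((W \ A).filter (fun v => (A.filter (adj v)).card < s)).card * δ ≤ l * W.card := by
  let Φ : Finset ℕ → ℕ := fun A => ∑ v ∈ W, (s - (A.filter (adj v)).card)
  obtain ⟨A, hA, hmin⟩ := Finset.exists_min_image W.powerset (fun A => l * A.card + Φ A)
    ⟨∅, by simp⟩
  rw [Finset.mem_powerset] at hA
  refine ⟨A, hA, ?_, ?_⟩
  · have := hmin ∅ (by simp)
    simp [Φ] at this
    have h2 : W.card * s = s * W.card := mul_comm _ _
    omega
  · set U := (W \ A).filter (fun v => (A.filter (adj v)).card < s) with hU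
    have key : ∀ a ∈ W \ A, (U.filter (fun u => adj u a)).card ≤ l := by
      intro a ha
      rw [Finset.mem_sdiff] at ha
      have h1 := hmin (insert a A) (by
        rw [Finset.mem_powerset]; exact Finset.insert_subset ha.1 hA)
      rw [Finset.card_insert_of_notMem ha.2] at h1
      have h2 : Φ (insert a A) + (U.filter (fun u => adj u a)).card ≤ Φ A := by
        have : (U.filter (fun u => adj u a)).card = ∑ v ∈ W, if v ∈ U ∧ adj v a then 1 else 0 := by
          rw [Finset.card_eq_sum_ones, ← Finset.sum_filter]
          apply Finset.sum_congr _ (fun _ _ => rfl)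
          ext u; simp only [Finset.mem_filter, hU, Finset.mem_sdiff]; tauto
        rw [this]
        simp only [Φ]
        rw [← Finset.sum_add_distrib]
        apply Finset.sum_le_sum
        intro v hv
        by_cases hva : adj v a
        · rw [Finset.filter_insert, if_pos hva, Finset.card_insert_of_notMem (by simp [ha.2])]
          split_ifs with h
          · have := (Finset.mem_filter.mp h.1).2
            omega
          · omega
        · rw [Finset.filter_insert, if_neg hva]
          simp [hva]
      have : l * (A.card + 1) = l * A.card + l := by ring
      omega
    have dc := Finset.sum_card_bipartiteAbove_eq_sum_card_bipartiteBelow (s := U) (t := W \ A) adj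
    have h1 : U.card * δ ≤ ∑ u ∈ U, (Finset.bipartiteAbove adj (W \ A) u).card := by
      rw [← smul_eq_mul]
      apply Finset.card_nsmul_le_sum
      intro u hu
      have hu' := Finset.mem_filter.mp hu
      have := hdeg u (Finset.mem_sdiff.mp hu'.1).1
      have h3 : (W.filter (adj u)).card ≤ (A.filter (adj u)).card + ((W \ A).filter (adj u)).card := by
        have h4 : W.filter (adj u) = A.filter (adj u) ∪ (W \ A).filter (adj u) := by
          rw [← Finset.filter_union, Finset.union_sdiff_of_subset hA]
        rw [h4]
        exact Finset.card_union_le _ _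
      have h5 : (Finset.bipartiteAbove adj (W \ A) u).card = ((W \ A).filter (adj u)).card := rfl
      omega
    have h2 : ∑ a ∈ W \ A, (Finset.bipartiteBelow adj U a).card ≤ (W \ A).card * l := by
      rw [← smul_eq_mul]
      apply Finset.sum_le_card_nsmul
      intro a ha
      exact key a ha
    have h3 : (W \ A).card ≤ W.card := Finset.card_le_card Finset.sdiff_subset
    calc U.card * δ ≤ (W \ A).card * l := by rw [dc] at h1; exact h1.trans h2
      _ ≤ W.card * l := Nat.mul_le_mul_right _ h3
      _ = l * W.card := mul_comm _ _

theorem core (V : Finset ℕ) (adj : ℕ → ℕ → Prop) (hs : ∀ x y, adj x y → adj y x)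
    (hirr : ∀ x, ¬ adj x x) (ρ : Finset ℕ → ℕ) (D K s0 s C : ℕ)
    (hZ : ∀ W ⊆ V, ∀ v ∈ V, v ∉ W → D ≤ (W.filter (adj v)).card → ρ W + D ≤ ρ (insert v W))
    (hG : ∀ W ⊆ V, ∀ v ∈ V, v ∉ W → s0 ≤ (W.filter (adj v)).card →
      ∀ x ∈ W, ∀ y ∈ W, adj v x → adj v y → x ≠ y → ¬ adj x y → ρ W + (D + 1) ≤ ρ (insert v W))
    (hR : ∀ W ⊆ V, ρ W ≤ D * W.card + K)
    (hss : s = (D + 1) * s0 + 2 * D + K + s0 + D + 1)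
    (hC : C = 2 + 2 * s + 16 * (D + 1) * (16 * (D + 1) * s) + 4 * K + D)
    (hV : C < V.card)
    (hconn : ∀ S ⊆ V, ∀ X ⊆ V, X.Nonempty → Disjoint X S → (∃ y ∈ V, y ∉ X ∧ y ∉ S) →
      (∀ x ∈ X, ∀ y ∈ V, y ∉ X → y ∉ S → ¬ adj x y) → C ≤ S.card) :
    ∀ x ∈ V, ∀ y ∈ V, x ≠ y → adj x y := by
  by_contra hnc
  -- common clique neighbours
  have hU : ∀ x ∈ V, ∀ y ∈ V, x ≠ y → ¬ adj x y → ∀ A ⊆ V, (∀ a ∈ A, adj a x ∧ adj a y) →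
      (∀ a ∈ A, ∀ b ∈ A, a ≠ b → adj a b) → A.card < s := by
    intro x hx y hy hxy hnxy A hA hAxy hAc
    by_contra hlt
    push Not at hlt
    obtain ⟨A0, hA0, hA0c⟩ := Finset.exists_subset_card_eq (s := A) (n := s0) (by
      have : s0 ≤ s := by rw [hss]; omega
      omega)
    have hxA : x ∉ A := fun h => hirr x (hAxy x h).1
    have hyA : y ∉ A := fun h => hirr y (hAxy y h).2
    have h1 := order_sum ρ (insert x (insert y A0)) (fun n => (n : ℤ)) (fun a b h => by simpa using h)
      (fun _ => D + 1) (A \ A0) (by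
        intro v hv
        have hv' := Finset.mem_sdiff.mp hv
        have hsub : insert x (insert y A0) ∪ (A \ A0).filter (fun u => (u : ℤ) < (v : ℤ)) ⊆ V := by
          intro z hz
          simp only [Finset.mem_union, Finset.mem_insert, Finset.mem_filter, Finset.mem_sdiff] at hz
          rcases hz with (rfl | rfl | hz) | hz
          · exact hx
          · exact hy
          · exact hA (hA0 hz)
          · exact hA hz.1.1
        apply hG _ hsub v (hA hv'.1) _ _ x (by simp) y (by simp) (hAxy v hv'.1).1 (hAxy v hv'.1).2 hxy hnxy
        · simp only [Finset.mem_union, Finset.mem_insert, Finset.mem_filter, Finset.mem_sdiff]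
          rintro ((rfl | rfl | hz) | hz)
          · exact hxA hv'.1
          · exact hyA hv'.1
          · exact hv'.2 hz
          · exact lt_irrefl _ hz.2
        · rw [← hA0c]
          apply Finset.card_le_card
          intro z hz
          simp only [Finset.mem_union, Finset.mem_insert, Finset.mem_filter]
          refine ⟨Or.inl (Or.inr (Or.inr hz)), hAc v hv'.1 z (hA0 hz) ?_⟩
          rintro rfl
          exact hv'.2 hz)
    have h2 : insert x (insert y A0) ∪ (A \ A0) = insert x (insert y A) := by
      ext z; simp only [Finset.mem_union, Finset.mem_insert, Finset.mem_sdiff]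
      have := @hA0 z
      tauto
    rw [h2] at h1
    have h3 := hR (insert x (insert y A)) (by
      intro z hz
      simp only [Finset.mem_insert] at hz
      rcases hz with rfl | rfl | hz
      · exact hx
      · exact hy
      · exact hA hz)
    rw [Finset.card_insert_of_notMem (by simp [hxy, hxA]), Finset.card_insert_of_notMem hyA] at h3
    rw [Finset.sum_const, smul_eq_mul, Finset.card_sdiff_of_subset hA0, hA0c] at h1
    obtain ⟨m, hm⟩ : ∃ m, A.card = m + s0 := ⟨A.card - s0, by
      have := Finset.card_le_card hA0
      omega⟩
    rw [hm] at h1 h3 hlt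
    simp only [Nat.add_sub_cancel] at h1
    nlinarith
  have hdeg : ∀ v ∈ V, C ≤ (V.filter (adj v)).card := by
    intro v hv
    by_contra hlt
    push Not at hlt
    refine absurd (hconn (V.filter (adj v)) (Finset.filter_subset _ _) {v} (by simpa using hv)
      (by simp) (by simp [hirr]) ?_ ?_) (by omega)
    · by_contra hno
      push Not at hno
      have : V ⊆ insert v (V.filter (adj v)) := by
        intro y hy
        by_cases h : y = v
        · simp [h]
        · exact Finset.mem_insert_of_mem (hno y hy (by simpa using h))
      have h1 := Finset.card_le_card this
      have h2 := Finset.card_insert_le v (V.filter (adj v))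
      omega
    · intro x hx y hy hyx hyn
      simp only [Finset.mem_singleton] at hx
      subst hx
      intro h
      exact hyn (by simp [hy, h])
  set W := V.filter (fun v => ∃ x ∈ V, ∃ y ∈ V, adj v x ∧ adj v y ∧ x ≠ y ∧ ¬ adj x y) with hW
  have hWV : W ⊆ V := Finset.filter_subset _ _
  have hsimp : ∀ v ∈ V, v ∉ W → ∀ x ∈ V, ∀ y ∈ V, adj v x → adj v y → x ≠ y → adj x y := by
    intro v hv hvW x hx y hy hvx hvy hxy
    by_contra hn
    exact hvW (by simp only [hW, Finset.mem_filter]; exact ⟨hv, x, hx, y, hy, hvx, hvy, hxy, hn⟩)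
  -- simplicial vertices have many neighbours in W
  have hsW : ∀ v ∈ V, v ∉ W → C ≤ (W.filter (adj v)).card := by
    intro v hv hvW
    refine hconn _ ((Finset.filter_subset _ _).trans hWV)
      (V.filter (fun u => u ∉ W ∧ (u = v ∨ adj v u))) (Finset.filter_subset _ _)
      ⟨v, by simp [hv, hvW]⟩ ?_ ?_ ?_
    · rw [Finset.disjoint_left]
      intro a ha hb
      exact (Finset.mem_filter.mp ha).2.1 (Finset.mem_filter.mp hb).1
    · by_contra hno
      push Not at hno
      apply hnc
      have hall : ∀ y ∈ V, y = v ∨ adj v y := by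
        intro y hy
        by_contra h
        push Not at h
        have := hno y hy (by simp [h])
        exact h.2 (Finset.mem_filter.mp this).2
      intro x hx y hy hxy
      rcases hall x hx with rfl | h1
      · rcases hall y hy with rfl | h2
        · exact absurd rfl hxy
        · exact h2
      · rcases hall y hy with rfl | h2
        · exact hs _ _ h1
        · exact hsimp v hv hvW x hx y hy h1 h2 hxy
    · intro x hx y hy hyX hyS hxy
      simp only [Finset.mem_filter] at hx hyX hyS
      have hyv : ¬ (y = v ∨ adj v y) := by
        intro h
        by_cases hyW : y ∈ W
        · rcases h with rfl | h
          · exact hvW hyW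
          · exact hyS ⟨hyW, h⟩
        · exact hyX ⟨hy, hyW, h⟩
      push Not at hyv
      rcases hx.2.2 with rfl | hvx
      · exact hyv.2 hxy
      · exact hyv.2 (hsimp x hx.1 hx.2.1 v hv y hy (hs _ _ hvx) hxy (Ne.symm hyv.1))
  have hWcard : C ≤ W.card := by
    by_cases h : ∃ v ∈ V, v ∉ W
    · obtain ⟨v, hv, hvW⟩ := h
      exact (hsW v hv hvW).trans (Finset.card_le_card (Finset.filter_subset _ _))
    · push Not at h
      have := Finset.card_le_card (show V ⊆ W from h)
      omega
  -- degrees in W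
  have hdW : ∀ v ∈ W, C ≤ (W.filter (adj v)).card + 1 := by
    intro v hv
    by_cases h : ∃ u ∈ V, u ∉ W ∧ adj v u
    · obtain ⟨u, hu, huW, hvu⟩ := h
      have h1 := hsW u hu huW
      have h2 : W.filter (adj u) ⊆ insert v (W.filter (adj v)) := by
        intro z hz
        have hz' := Finset.mem_filter.mp hz
        by_cases hzv : z = v
        · simp [hzv]
        · apply Finset.mem_insert_of_mem
          simp only [Finset.mem_filter]
          exact ⟨hz'.1, hsimp u hu huW v (hWV hv) z (hWV hz'.1) (hs _ _ hvu) hz'.2 (Ne.symm hzv)⟩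
      have := Finset.card_le_card h2
      have := Finset.card_insert_le v (W.filter (adj v))
      omega
    · push Not at h
      have h1 := hdeg v (hWV hv)
      have h2 : V.filter (adj v) ⊆ W.filter (adj v) := by
        intro z hz
        have hz' := Finset.mem_filter.mp hz
        simp only [Finset.mem_filter]
        refine ⟨?_, hz'.2⟩
        by_contra hzW
        exact h z hz'.1 hzW hz'.2
      have := Finset.card_le_card h2
      omega
  -- replacing simplicial neighbours
  have hrep : ∀ v ∈ W, ∀ x ∈ V, ∀ y ∈ V, adj v x → adj v y → x ≠ y → ¬ adj x y →
      ∃ x' ∈ W, adj v x' ∧ x' ≠ y ∧ ¬ adj x' y := by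
    intro v hv x hx y hy hvx hvy hxy hnxy
    by_cases hxW : x ∈ W
    · exact ⟨x, hxW, hvx, hxy, hnxy⟩
    · by_contra hno
      push Not at hno
      have h1 := hsW x hx hxW
      have h2 := hU x hx y hy hxy hnxy (W.filter (adj x)) ((Finset.filter_subset _ _).trans hWV) (by
        intro a ha
        have ha' := Finset.mem_filter.mp ha
        refine ⟨hs _ _ ha'.2, ?_⟩
        by_cases hav : a = v
        · rw [hav]; exact hvy
        · apply hno a ha'.1
          · exact hsimp x hx hxW v (hWV hv) a (hWV ha'.1) (hs _ _ hvx) ha'.2 (Ne.symm hav)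
          · rintro rfl; exact hnxy ha'.2) (by
        intro a ha b hb hab
        have ha' := Finset.mem_filter.mp ha
        have hb' := Finset.mem_filter.mp hb
        exact hsimp x hx hxW a (hWV ha'.1) b (hWV hb'.1) ha'.2 hb'.2 hab)
      omega
  have hpair : ∀ v ∈ W, ∃ x ∈ W, ∃ y ∈ W, adj v x ∧ adj v y ∧ x ≠ y ∧ ¬ adj x y := by
    intro v hv
    obtain ⟨_, x, hx, y, hy, hvx, hvy, hxy, hn⟩ := Finset.mem_filter.mp hv
    obtain ⟨x', hx', hvx', hxy', hn'⟩ := hrep v hv x hx y hy hvx hvy hxy hn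
    obtain ⟨y', hy', hvy', hxy'', hn''⟩ := hrep v hv y hy x' (hWV hx') hvy hvx' (Ne.symm hxy')
      (fun h => hn' (hs _ _ h))
    exact ⟨x', hx', y', hy', hvx', hvy', Ne.symm hxy'', fun h => hn'' (hs _ _ h)⟩
  obtain ⟨A, hAW, hAc, hUc⟩ := exists_dom adj hs W s (16 * (D + 1) * s)
    (16 * (D + 1) * (16 * (D + 1) * s)) (by
      intro v hv
      have := hdW v hv
      omega)
  set U := (W \ A).filter (fun v => (A.filter (adj v)).card < s) with hUdef
  set R := (W \ A).filter (fun v => ¬ (A.filter (adj v)).card < s) with hRdef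
  have hUR : (A ∪ U) ∪ R = W := by
    rw [Finset.union_assoc, hUdef, hRdef, Finset.filter_union_filter_not_eq, Finset.union_sdiff_of_subset hAW]
  have hcards : A.card + U.card + R.card = W.card := by
    have h1 := Finset.card_filter_add_card_filter_not (s := W \ A) (fun v => (A.filter (adj v)).card < s)
    have h2 := Finset.card_sdiff_add_card_eq_card hAW
    rw [← hUdef, ← hRdef] at h1
    omega
  -- gain
  have hgain : ∀ v ∈ R, ∃ x ∈ W, ∃ a ∈ A, adj v x ∧ adj v a ∧ x ≠ a ∧ ¬ adj x a := by
    intro v hv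
    have hv' := Finset.mem_filter.mp hv
    have hvW := (Finset.mem_sdiff.mp hv'.1).1
    by_contra hno
    push Not at hno
    obtain ⟨x, hx, y, hy, hvx, hvy, hxy, hn⟩ := hpair v hvW
    -- neither x nor y is in A
    have hxA : x ∉ A := fun h => hn (hs _ _ (hno y hy x h hvy hvx (Ne.symm hxy)))
    have hyA : y ∉ A := fun h => hn (hno x hx y h hvx hvy hxy)
    have := hU x (hWV hx) y (hWV hy) hxy hn (A.filter (adj v))
      ((Finset.filter_subset _ _).trans (hAW.trans hWV)) (by
        intro a ha
        have ha' := Finset.mem_filter.mp ha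
        constructor
        · apply hs; apply hno x hx a ha'.1 hvx ha'.2
          rintro rfl; exact hxA ha'.1
        · apply hs; apply hno y hy a ha'.1 hvy ha'.2
          rintro rfl; exact hyA ha'.1) (by
        intro a ha b hb hab
        have ha' := Finset.mem_filter.mp ha
        have hb' := Finset.mem_filter.mp hb
        exact hno a (hAW ha'.1) b hb'.1 ha'.2 hb'.2 hab)
    exact hv'.2 this
  choose! X hX a haA hvX hva hXa hnXa using hgain
  -- one order
  have hord : ∀ f : ℕ → ℤ, Function.Injective f →
      ∑ v ∈ R, (D + if f (X v) < f v ∨ X v ∉ R then 1 else 0) ≤ ρ W := by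
    intro f hf
    have := order_sum ρ (A ∪ U) f hf (fun v => D + if f (X v) < f v ∨ X v ∉ R then 1 else 0) R (by
      intro v hv
      have hv' := Finset.mem_filter.mp hv
      have hv2 := (Finset.mem_sdiff.mp hv'.1)
      have hsub : (A ∪ U) ∪ R.filter (fun u => f u < f v) ⊆ V := by
        refine Finset.Subset.trans ?_ hWV
        rw [← hUR]
        exact Finset.union_subset_union_right (Finset.filter_subset _ _)
      have hnot : v ∉ (A ∪ U) ∪ R.filter (fun u => f u < f v) := by
        simp only [Finset.mem_union, Finset.mem_filter, lt_irrefl, and_false, or_false]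
        rintro (h | h)
        · exact hv2.2 h
        · exact hv'.2 (Finset.mem_filter.mp h).2
      have hcard : s ≤ (((A ∪ U) ∪ R.filter (fun u => f u < f v)).filter (adj v)).card := by
        refine (not_lt.mp hv'.2).trans (Finset.card_le_card ?_)
        apply Finset.filter_subset_filter
        exact Finset.subset_union_left.trans Finset.subset_union_left
      have hs0 : s0 ≤ s := by rw [hss]; omega
      have hsD : D ≤ s := by rw [hss]; omega
      by_cases hc : f (X v) < f v ∨ X v ∉ R
      · simp only [if_pos hc]
        refine hG _ hsub v (hWV hv2.1) hnot (hs0.trans hcard) (X v) ?_ (a v) ?_ (hvX v hv) (hva v hv)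
          (hXa v hv) (hnXa v hv)
        · by_cases hXR : X v ∈ R
          · apply Finset.mem_union_right
            rw [Finset.mem_filter]
            exact ⟨hXR, by tauto⟩
          · apply Finset.mem_union_left
            have := hX v hv
            rw [← hUR] at this
            exact (Finset.mem_union.mp this).resolve_right hXR
        · exact Finset.mem_union_left _ (Finset.mem_union_left _ (haA v hv))
      · simp only [if_neg hc, add_zero]
        exact hZ _ hsub v (hWV hv2.1) hnot (hsD.trans hcard))
    rw [hUR] at this
    omega
  have ho1 := hord (fun n => (n : ℤ)) (fun a b h => by simpa using h)
  have ho2 := hord (fun n => -(n : ℤ)) (fun a b h => by simpa using h)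
  have hboth : R.card * (2 * D + 1) ≤ 2 * ρ W := by
    have hadd := add_le_add ho1 ho2
    rw [two_mul (ρ W)]
    refine le_trans ?_ hadd
    rw [← Finset.sum_add_distrib, ← smul_eq_mul]
    apply Finset.card_nsmul_le_sum
    intro v hv
    have hne : X v ≠ v := fun h => hirr v (by have := hvX v hv; rwa [h] at this)
    by_cases h1 : X v < v
    · have : ((X v : ℕ) : ℤ) < (v : ℤ) ∨ X v ∉ R := Or.inl (by exact_mod_cast h1)
      rw [if_pos this]; omega
    · have : -((X v : ℕ) : ℤ) < -(v : ℤ) ∨ X v ∉ R := Or.inl (by omega)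
      rw [if_pos this]; omega
  have hfin := order_sum ρ W (fun n => (n : ℤ)) (fun a b h => by simpa using h) (fun _ => D) (V \ W) (by
    intro v hv
    have hv' := Finset.mem_sdiff.mp hv
    apply hZ _ _ v hv'.1
    · simp [hv'.2]
    · have h1 := hsW v hv'.1 hv'.2
      have : (W.filter (adj v)).card ≤
        ((W ∪ (V \ W).filter (fun u => (u : ℤ) < (v : ℤ))).filter (adj v)).card :=
        Finset.card_le_card (Finset.filter_subset_filter _ Finset.subset_union_left)
      have hCD : D ≤ C := by rw [hC]; omega
      omega
    · exact Finset.union_subset hWV ((Finset.filter_subset _ _).trans Finset.sdiff_subset))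
  rw [Finset.union_sdiff_of_subset hWV, Finset.sum_const, smul_eq_mul] at hfin
  have hRV := hR V (Finset.Subset.refl _)
  have hVW := Finset.card_sdiff_add_card_eq_card hWV
  have hspos : 0 < s := by rw [hss]; omega
  have hA' : 16 * (D + 1) * A.card ≤ W.card := by
    have : s * (16 * (D + 1) * A.card) ≤ s * W.card := by nlinarith
    exact Nat.le_of_mul_le_mul_left this hspos
  have hU' : 16 * (D + 1) * U.card ≤ W.card := by
    have : (16 * (D + 1) * s) * (16 * (D + 1) * U.card) ≤ (16 * (D + 1) * s) * W.card := by
      calc _ = U.card * (16 * (D + 1) * (16 * (D + 1) * s)) := by ring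
        _ ≤ _ := hUc
    exact Nat.le_of_mul_le_mul_left this (by positivity)
  have hK : 4 * K + 2 ≤ W.card := by omega
  rw [← hVW, ← hcards] at hRV
  rw [← hcards] at hA' hU' hK
  nlinarith
end LYU
namespace LYU
open Classical

variable {N : GraphMatroidFamily}

/-- star edges -/
def star (v : ℕ) (T : Finset ℕ) : Set (Sym2 ℕ) := (fun x => s(v, x)) '' (T : Set ℕ)

lemma star_finite (v : ℕ) (T : Finset ℕ) : (star v T).Finite := T.finite_toSet.image _

lemma mem_star {v : ℕ} {T : Finset ℕ} {e : Sym2 ℕ} : e ∈ star v T ↔ ∃ x ∈ T, s(v, x) = e := by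
  simp [star]

lemma star_mono {v : ℕ} {T T' : Finset ℕ} (h : T ⊆ T') : star v T ⊆ star v T' :=
  Set.image_mono (by exact_mod_cast h)

lemma star_ncard (v : ℕ) (T : Finset ℕ) : (star v T).ncard = T.card := by
  rw [star, Set.ncard_image_of_injective, Set.ncard_coe_finset]
  intro a b h
  simp at h
  rcases h with h | ⟨h1, h2⟩
  · exact h
  · exact h2.trans h1

lemma mem_ground {e : Sym2 ℕ} : e ∈ N.M.E ↔ ¬ e.IsDiag := by
  rw [N.ground_eq]; rfl

lemma star_disj {v : ℕ} {T : Finset ℕ} {I : Set (Sym2 ℕ)} (hv : v ∉ eSupp I) :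
    Disjoint I (star v T) := by
  rw [Set.disjoint_left]
  intro e he hs
  obtain ⟨x, hx, rfl⟩ := mem_star.mp hs
  exact hv ⟨_, he, by simp⟩

lemma clique_subset_ground (V : Set ℕ) : clique V ⊆ N.M.E := by
  intro e he
  exact mem_ground.mpr he.1

lemma mk_mem_clique {V : Set ℕ} {x y : ℕ} : s(x, y) ∈ clique V ↔ x ≠ y ∧ x ∈ V ∧ y ∈ V := by
  simp [clique]

lemma clique_mono {V W : Set ℕ} (h : V ⊆ W) : clique V ⊆ clique W :=
  fun _ he => ⟨he.1, fun v hv => h (he.2 v hv)⟩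

lemma clique_finite (V : Finset ℕ) : (clique (V : Set ℕ)).Finite := by
  apply (V.sym2.finite_toSet).subset
  intro e he
  simp only [Finset.mem_coe, Finset.mem_sym2_iff]
  intro a ha
  exact_mod_cast he.2 a ha

lemma clique_ncard_le (V : Finset ℕ) : (clique (V : Set ℕ)).ncard ≤ (V.card + 1) * (V.card + 1) := by
  have : (clique (V : Set ℕ)).ncard ≤ (V.sym2 : Set (Sym2 ℕ)).ncard := by
    apply Set.ncard_le_ncard _ (V.sym2.finite_toSet)
    intro e he
    simp only [Finset.mem_coe, Finset.mem_sym2_iff]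
    intro a ha
    exact_mod_cast he.2 a ha
  rw [Set.ncard_coe_finset, Finset.card_sym2, Nat.choose_two_right] at this
  refine this.trans ((Nat.div_le_self _ _).trans ?_)
  exact Nat.mul_le_mul_left _ (by omega)

lemma eSupp_union (A B : Set (Sym2 ℕ)) : eSupp (A ∪ B) = eSupp A ∪ eSupp B := by
  ext v; simp only [eSupp, Set.mem_union, Set.mem_ofPred_eq]
  constructor
  · rintro ⟨e, he | he, hv⟩
    · exact Or.inl ⟨e, he, hv⟩
    · exact Or.inr ⟨e, he, hv⟩
  · rintro (⟨e, he, hv⟩ | ⟨e, he, hv⟩)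
    · exact ⟨e, Or.inl he, hv⟩
    · exact ⟨e, Or.inr he, hv⟩

lemma eSupp_mono {A B : Set (Sym2 ℕ)} (h : A ⊆ B) : eSupp A ⊆ eSupp B :=
  fun _ ⟨e, he, hv⟩ => ⟨e, h he, hv⟩

lemma eSupp_star {v : ℕ} {T : Finset ℕ} {x : ℕ} (h : x ∈ eSupp (star v T)) : x = v ∨ x ∈ T := by
  obtain ⟨e, he, hx⟩ := h
  obtain ⟨y, hy, rfl⟩ := mem_star.mp he
  rw [Sym2.mem_iff] at hx
  rcases hx with rfl | rfl
  · exact Or.inl rfl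
  · exact Or.inr hy

lemma eSupp_finite {I : Set (Sym2 ℕ)} (h : I.Finite) : (eSupp I).Finite := by
  have : eSupp I = ⋃ e ∈ I, {v | v ∈ e} := by ext v; simp [eSupp]
  rw [this]
  apply h.biUnion
  intro e _
  induction e with
  | _ x y =>
    apply (Set.toFinite {x, y}).subset
    intro v hv
    simpa using hv

lemma eSupp_clique {V : Set ℕ} {I : Set (Sym2 ℕ)} (h : I ⊆ clique V) : eSupp I ⊆ V := by
  rintro v ⟨e, he, hv⟩
  exact (h he).2 v hv

/-! rank -/
lemma indep_finite_le (M : Matroid (Sym2 ℕ)) {B I X : Set (Sym2 ℕ)} (hB : M.IsBasis B X) (hX : X.Finite)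
    (hI : M.Indep I) (hIX : I ⊆ X) : I.ncard ≤ B.ncard := by
  obtain ⟨J, hJ, hIJ⟩ := hI.subset_isBasis_of_subset hIX hB.subset_ground
  have h1 := hJ.encard_eq_encard hB
  have h2 : J.ncard = B.ncard := by rw [Set.ncard_def, Set.ncard_def, h1]
  rw [← h2]
  exact Set.ncard_le_ncard hIJ (hX.subset hJ.subset)

lemma mrk_eq (M : Matroid (Sym2 ℕ)) {B X : Set (Sym2 ℕ)} (hB : M.IsBasis B X) (hX : X.Finite) :
    mrk M X = B.ncard := by
  apply le_antisymm
  · refine csSup_le ⟨B.ncard, B, hB.subset, hB.indep, rfl⟩ ?_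
    rintro n ⟨I, hIX, hI, rfl⟩
    exact indep_finite_le M hB hX hI hIX
  · apply le_csSup
    · refine ⟨B.ncard, ?_⟩
      rintro n ⟨I, hIX, hI, rfl⟩
      exact indep_finite_le M hB hX hI hIX
    · exact ⟨B, hB.subset, hB.indep, rfl⟩

lemma subset_closure_of_mrk (M : Matroid (Sym2 ℕ)) {X Y : Set (Sym2 ℕ)} (hXY : X ⊆ Y) (hY : Y.Finite)
    (hYE : Y ⊆ M.E) (h : mrk M X = mrk M Y) : Y ⊆ M.closure X := by
  obtain ⟨B, hB⟩ := M.exists_isBasis X (hXY.trans hYE)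
  obtain ⟨J, hJ, hBJ⟩ := hB.indep.subset_isBasis_of_subset (hB.subset.trans hXY) hYE
  rw [mrk_eq M hB (hY.subset hXY), mrk_eq M hJ hY] at h
  have : B = J := Set.eq_of_subset_of_ncard_le hBJ h.ge (hY.subset hJ.subset)
  subst this
  exact hJ.subset_closure.trans (M.closure_mono hB.subset)

lemma mrk_of_subset_closure (M : Matroid (Sym2 ℕ)) {X Y : Set (Sym2 ℕ)} (hXY : X ⊆ Y) (hY : Y.Finite)
    (hYE : Y ⊆ M.E) (h : Y ⊆ M.closure X) : mrk M X = mrk M Y := by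
  obtain ⟨B, hB⟩ := M.exists_isBasis X (hXY.trans hYE)
  have hJ : M.IsBasis B Y := by
    apply hB.indep.isBasis_of_subset_of_subset_closure (hB.subset.trans hXY)
    rwa [hB.closure_eq_closure]
  rw [mrk_eq M hB (hY.subset hXY), mrk_eq M hJ hY]

/-! complete bipartite graphs -/
/-- complete bipartite graph -/
def bip (S T : Finset ℕ) : Set (Sym2 ℕ) := ⋃ w ∈ T, star w S

lemma mem_bip {S T : Finset ℕ} {x y : ℕ} (hx : x ∈ S) (hy : y ∈ T) : s(x, y) ∈ bip S T := by
  simp only [bip, Set.mem_iUnion]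
  exact ⟨y, hy, mem_star.mpr ⟨x, hx, Sym2.eq_swap⟩⟩

lemma eSupp_bip {S T : Finset ℕ} (hS : S.Nonempty) (hT : T.Nonempty) :
    eSupp (bip S T) = (S ∪ T : Finset ℕ) := by
  obtain ⟨a, ha⟩ := hS
  obtain ⟨b, hb⟩ := hT
  ext v
  constructor
  · rintro ⟨e, he, hv⟩
    simp only [bip, Set.mem_iUnion] at he
    obtain ⟨w, hw, he⟩ := he
    rcases eSupp_star ⟨e, he, hv⟩ with rfl | h
    · simp [hw]
    · simp [h]
  · intro hv
    simp only [Finset.coe_union, Set.mem_union, Finset.mem_coe] at hv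
    rcases hv with hv | hv
    · exact ⟨_, mem_bip hv hb, by simp⟩
    · exact ⟨_, mem_bip ha hv, by simp⟩

lemma bip_isGraph {S T : Finset ℕ} (hd : Disjoint S T) : IsGraph (bip S T) := by
  constructor
  · exact T.finite_toSet.biUnion (fun w _ => star_finite w S)
  · intro e he
    simp only [bip, Set.mem_iUnion] at he
    obtain ⟨w, hw, he⟩ := he
    obtain ⟨x, hx, rfl⟩ := mem_star.mp he
    simp only [Sym2.mk_isDiag_iff]
    rintro rfl
    exact Finset.disjoint_left.mp hd hx hw

lemma bip_conn {S T : Finset ℕ} (hd : Disjoint S T) (c : ℕ) (hS : c < S.card) (hT : c < T.card) :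
    KConnected c (bip S T) := by
  have hSn : S.Nonempty := Finset.card_pos.mp (by omega)
  have hTn : T.Nonempty := Finset.card_pos.mp (by omega)
  unfold KConnected
  rw [eSupp_bip hSn hTn]
  constructor
  · rw [Set.ncard_coe_finset, Finset.card_union_of_disjoint hd]; omega
  · intro Q hQ
    have hex : ∀ P : Finset ℕ, c < P.card → ∃ a ∈ P, a ∉ Q := by
      intro P hP
      by_contra h
      push Not at h
      have := Finset.card_le_card (show P ⊆ Q from h)
      omega
    obtain ⟨a, ha, haQ⟩ := hex S hS
    obtain ⟨b, hb, hbQ⟩ := hex T hT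
    have hne : ∀ x ∈ S, ∀ y ∈ T, x ≠ y := fun x hx y hy h => Finset.disjoint_left.mp hd hx (h ▸ hy)
    rw [SimpleGraph.connected_iff_exists_forall_reachable]
    have hadj : ∀ x y (hx : x ∈ S) (hy : y ∈ T) (hxQ : x ∉ Q) (hyQ : y ∉ Q),
        ((SimpleGraph.fromEdgeSet (bip S T)).induce (((S ∪ T : Finset ℕ) : Set ℕ) \ ↑Q)).Adj
          ⟨x, by simp [hx, hxQ]⟩ ⟨y, by simp [hy, hyQ]⟩ := by
      intro x y hx hy hxQ hyQ
      simp only [SimpleGraph.comap_adj, SimpleGraph.fromEdgeSet_adj, Function.Embedding.subtype_apply]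
      exact ⟨mem_bip hx hy, hne x hx y hy⟩
    refine ⟨⟨a, by simp [ha, haQ]⟩, ?_⟩
    rintro ⟨v, hv⟩
    have hvQ : v ∉ Q := by simpa using hv.2
    have hv1 : v ∈ S ∨ v ∈ T := by simpa using hv.1
    rcases hv1 with h | h
    · exact (hadj a b ha hb haQ hbQ).reachable.trans (hadj v b h hb hvQ hbQ).symm.reachable
    · exact (hadj a v ha h haQ hvQ).reachable

/-- Rigidity of highly connected graphs with parameter `c`. -/
def LYc (N : GraphMatroidFamily) (c : ℕ) : Prop :=
  ∀ E : Set (Sym2 ℕ), IsGraph E → KConnected c E → N.Rigid E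

lemma clique_subset_closure_bip {c : ℕ} (h : LYc N c) {S T : Finset ℕ} (hd : Disjoint S T)
    (hS : c < S.card) (hT : c < T.card) : clique (S : Set ℕ) ⊆ N.M.closure (bip S T) := by
  have hSn : S.Nonempty := Finset.card_pos.mp (by omega)
  have hTn : T.Nonempty := Finset.card_pos.mp (by omega)
  have hr := h _ (bip_isGraph hd) (bip_conn hd c hS hT)
  unfold GraphMatroidFamily.Rigid GraphMatroidFamily.rk at hr
  rw [eSupp_bip hSn hTn] at hr
  have hsub : bip S T ⊆ clique ((S ∪ T : Finset ℕ) : Set ℕ) := by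
    intro e he
    refine ⟨(bip_isGraph hd).2 e he, fun v hv => ?_⟩
    rw [← eSupp_bip hSn hTn]
    exact ⟨e, he, hv⟩
  have := subset_closure_of_mrk N.M hsub (clique_finite _) (clique_subset_ground _) hr
  exact (clique_mono (by simp)).trans this

/-- Zero-extension property. -/
def Zx (N : GraphMatroidFamily) (d : ℕ) : Prop :=
  ∀ I : Set (Sym2 ℕ), I.Finite → N.M.Indep I → ∀ v, v ∉ eSupp I → ∀ T : Finset ℕ, v ∉ T →
    T.card ≤ d → N.M.Indep (I ∪ star v T)

lemma Zx.iter {d : ℕ} (h : Zx N d) {I : Set (Sym2 ℕ)} (hI : I.Finite) (hInd : N.M.Indep I)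
    (T : Finset ℕ) (hT : T.card ≤ d) (P : Finset ℕ) (hP : ∀ w ∈ P, w ∉ eSupp I ∧ w ∉ T) :
    N.M.Indep (I ∪ bip T P) := by
  induction P using Finset.induction_on with
  | empty => simpa [bip] using hInd
  | insert a P ha ih =>
    have ih' := ih (fun w hw => hP w (Finset.mem_insert_of_mem hw))
    have haP := hP a (Finset.mem_insert_self _ _)
    have h1 := h (I ∪ bip T P) (hI.union (P.finite_toSet.biUnion (fun w _ => star_finite w T))) ih' a (by
      rw [eSupp_union]
      rintro (h | ⟨e, he, hv⟩)
      · exact haP.1 h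
      · simp only [bip, Set.mem_iUnion] at he
        obtain ⟨w, hw, he⟩ := he
        rcases eSupp_star ⟨e, he, hv⟩ with rfl | h
        · exact ha hw
        · exact haP.2 h) T haP.2 hT
    convert h1 using 1
    simp only [bip, Finset.set_biUnion_insert]
    ext; simp only [Set.mem_union]; tauto

lemma Zx.contra {d c : ℕ} (h : Zx N d) (hc : LYc N c) {I : Set (Sym2 ℕ)} (hI : I.Finite)
    {S T : Finset ℕ} (hTS : T ⊆ S) (hT : T.card ≤ d) (hS : c < S.card) {e : Sym2 ℕ}
    (heI : e ∉ I) (he : e ∈ clique (S : Set ℕ)) (hIe : N.M.Indep (insert e I))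
    (hcl : ∀ w, w ∉ eSupp I → w ∉ S → star w S ⊆ N.M.closure (I ∪ star w T)) : False := by
  obtain ⟨P, hPd, hPc⟩ : ∃ P : Finset ℕ, (∀ w ∈ P, w ∉ eSupp I ∧ w ∉ S) ∧ c < P.card := by
    have hfin : (eSupp I ∪ S).Finite := (eSupp_finite hI).union S.finite_toSet
    obtain ⟨P, hP, hPc⟩ := hfin.infinite_compl.exists_subset_card_eq (c + 1)
    refine ⟨P, fun w hw => ?_, by omega⟩
    have := hP hw
    simpa using this
  have heS : eSupp (insert e I) ⊆ eSupp I ∪ S := by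
    rintro v ⟨f, rfl | hf, hv⟩
    · exact Or.inr (he.2 v hv)
    · exact Or.inl ⟨f, hf, hv⟩
  have h1 := h.iter (hI.insert e) hIe T hT P (by
    intro w hw
    refine ⟨fun hw' => ?_, fun hw' => (hPd w hw).2 (hTS hw')⟩
    rcases heS hw' with h | h
    · exact (hPd w hw).1 h
    · exact (hPd w hw).2 h)
  rw [Set.insert_union] at h1
  have heb : e ∉ I ∪ bip T P := by
    rintro (h | h)
    · exact heI h
    · simp only [bip, Set.mem_iUnion] at h
      obtain ⟨w, hw, h⟩ := h
      obtain ⟨x, hx, rfl⟩ := mem_star.mp h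
      exact (hPd w hw).2 (he.2 w (by simp))
  have h2 : bip S P ⊆ N.M.closure (I ∪ bip T P) := by
    intro f hf
    simp only [bip, Set.mem_iUnion] at hf
    obtain ⟨w, hw, hf⟩ := hf
    apply N.M.closure_mono _ (hcl w (hPd w hw).1 (hPd w hw).2 hf)
    apply Set.union_subset_union_right
    intro g hg
    simp only [bip, Set.mem_iUnion]
    exact ⟨w, hw, hg⟩
  have h3 := clique_subset_closure_bip hc (T := P)
    (Finset.disjoint_left.mpr (fun a ha haP => (hPd a haP).2 ha)) hS hPc he
  have h4 := N.M.closure_subset_closure_of_subset_closure h2 h3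
  have h5 := h1.notMem_closure_sdiff_of_mem (Set.mem_insert _ _)
  rw [Set.insert_sdiff_self_of_notMem heb] at h5
  exact h5 h4

/-! permutations -/
lemma image_star (σ : Equiv.Perm ℕ) (v : ℕ) (T : Finset ℕ) :
    Sym2.map σ '' star v T = star (σ v) (T.image σ) := by
  ext e
  simp only [Set.mem_image, mem_star, Finset.mem_image]
  constructor
  · rintro ⟨f, ⟨x, hx, rfl⟩, rfl⟩
    exact ⟨σ x, ⟨x, hx, rfl⟩, by simp⟩
  · rintro ⟨y, ⟨x, hx, rfl⟩, rfl⟩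
    exact ⟨_, ⟨x, hx, rfl⟩, by simp⟩

lemma image_eq_self (σ : Equiv.Perm ℕ) (I : Set (Sym2 ℕ)) (h : ∀ x ∈ eSupp I, σ x = x) :
    Sym2.map σ '' I = I := by
  have : ∀ e ∈ I, Sym2.map σ e = e := by
    intro e he
    induction e with
    | _ x y =>
      rw [Sym2.map_mk, h x ⟨_, he, by simp⟩, h y ⟨_, he, by simp⟩]
  rw [Set.image_congr this]; simp

lemma indep_image_iff (σ : Equiv.Perm ℕ) (I : Set (Sym2 ℕ)) :
    N.M.Indep (Sym2.map σ '' I) ↔ N.M.Indep I := by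
  refine ⟨fun h => ?_, N.invariant σ I⟩
  have := N.invariant σ⁻¹ _ h
  rw [← Set.image_comp, ← Sym2.map_comp] at this
  have h2 : (⇑σ⁻¹ ∘ ⇑σ) = id := by ext x; simp
  rw [h2, Sym2.map_id, Set.image_id] at this
  exact this

lemma exists_max_star {I : Set (Sym2 ℕ)} (hI : N.M.Indep I) (v : ℕ) (S : Finset ℕ) :
    ∃ T ⊆ S, N.M.Indep (I ∪ star v T) ∧ ∀ x ∈ S, x ∉ T → ¬ N.M.Indep (I ∪ star v (insert x T)) := by
  obtain ⟨T, hT, hmax⟩ := Finset.exists_max_image (S.powerset.filter (fun T => N.M.Indep (I ∪ star v T)))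
    Finset.card ⟨∅, by
      rw [Finset.mem_filter]
      exact ⟨by simp, by simpa [star] using hI⟩⟩
  simp only [Finset.mem_filter, Finset.mem_powerset] at hT hmax
  refine ⟨T, hT.1, hT.2, fun x hx hxT hind => ?_⟩
  have := hmax (insert x T) ⟨Finset.insert_subset hx hT.1, hind⟩
  rw [Finset.card_insert_of_notMem hxT] at this
  omega

lemma star_insert (v x : ℕ) (T : Finset ℕ) : star v (insert x T) = insert s(v, x) (star v T) := by
  simp [star, Set.image_insert_eq]

lemma Zx.gain {d c : ℕ} (h : Zx N d) (hc : LYc N c) {I : Set (Sym2 ℕ)} (hI : I.Finite)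
    {S : Finset ℕ} (hS : c < S.card) {e : Sym2 ℕ}
    (heI : e ∉ I) (he : e ∈ clique (S : Set ℕ)) (hIe : N.M.Indep (insert e I))
    {v : ℕ} (hvI : v ∉ eSupp I) (hvS : v ∉ S) :
    ∃ T ⊆ S, T.card = d + 1 ∧ N.M.Indep (I ∪ star v T) := by
  obtain ⟨T, hTS, hT, hmax⟩ := exists_max_star (hIe.subset (Set.subset_insert e I)) v S
  by_cases hTc : d + 1 ≤ T.card
  · obtain ⟨T', hT', hc'⟩ := Finset.exists_subset_card_eq hTc
    exact ⟨T', hT'.trans hTS, hc', hT.subset (Set.union_subset_union_right _ (star_mono hT'))⟩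
  exfalso
  refine h.contra hc hI hTS (by omega) hS heI he hIe ?_
  intro w hwI hwS
  have hfix : ∀ Q ⊆ S, Sym2.map (Equiv.swap v w) '' (I ∪ star v Q) = I ∪ star w Q := by
    intro Q hQ
    rw [Set.image_union, image_eq_self, image_star, Equiv.swap_apply_left]
    · congr 2
      rw [Finset.image_congr (g := id), Finset.image_id]
      intro x hx
      have hxS := hQ hx
      apply Equiv.swap_apply_of_ne_of_ne
      · rintro rfl; exact hvS hxS
      · rintro rfl; exact hwS hxS
    · intro x hx
      apply Equiv.swap_apply_of_ne_of_ne
      · rintro rfl; exact hvI hx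
      · rintro rfl; exact hwI hx
  have hTw : N.M.Indep (I ∪ star w T) := by
    rw [← hfix T hTS]; exact N.invariant _ _ hT
  intro f hf
  obtain ⟨x, hx, rfl⟩ := mem_star.mp hf
  by_cases hxT : x ∈ T
  · exact N.M.mem_closure_of_mem' (Or.inr (mem_star.mpr ⟨x, hxT, rfl⟩))
      (hTw.subset_ground (Or.inr (mem_star.mpr ⟨x, hxT, rfl⟩)))
  · have hni := hmax x hx hxT
    rw [← indep_image_iff (Equiv.swap v w), hfix _ (Finset.insert_subset hx hTS), star_insert,
      Set.union_insert] at hni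
    by_contra hncl
    apply hni
    rw [hTw.notMem_closure_iff (mem_ground.mpr (by
      simp only [Sym2.mk_isDiag_iff]; rintro rfl; exact hwS hx))] at hncl
    exact hncl.1

lemma exists_d {c : ℕ} (hc : LYc N c) : ∃ d, Zx N d ∧ ¬ Zx N (d + 1) := by
  by_contra hno
  push Not at hno
  have h0 : Zx N 0 := by
    intro I _ hI v _ T _ hT
    have : T = ∅ := by simpa using hT
    subst this
    simpa [star] using hI
  have hall : ∀ d, Zx N d := fun d => Nat.rec h0 (fun d hd => hno d hd) d
  have h1 := hall 1 ∅ Set.finite_empty (N.M.empty_indep) 0 (by simp [eSupp]) {1} (by simp) (by simp)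
  have h2 : ∅ ∪ star 0 {1} = insert s(0, 1) ∅ := by simp [star]
  rw [h2] at h1
  refine (hall (c + 2)).contra hc Set.finite_empty (S := Finset.range (c + 2)) (T := Finset.range (c + 2))
    (Finset.Subset.refl _) (by simp) (by simp) (by simp) ?_ h1 ?_
  · rw [mk_mem_clique]; simp
  · intro w _ hw
    refine N.M.subset_closure_of_subset' (by simp) ?_
    intro f hf
    obtain ⟨x, hx, rfl⟩ := mem_star.mp hf
    apply mem_ground.mpr
    simp only [Sym2.mk_isDiag_iff]; rintro rfl; exact hw hx
end LYU
namespace LYU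
open Classical

variable {N : GraphMatroidFamily}

lemma perm_step (σ : Equiv.Perm ℕ) (F : Finset ℕ) (a b : ℕ) (ha : a ∉ F) (hb : b ∉ F.image σ) :
    ∃ τ : Equiv.Perm ℕ, (∀ x ∈ F, τ x = σ x) ∧ τ a = b := by
  refine ⟨Equiv.swap (σ a) b * σ, fun x hx => ?_, by simp⟩
  rw [Equiv.Perm.mul_apply]
  apply Equiv.swap_apply_of_ne_of_ne
  · intro h
    exact ha (σ.injective h ▸ hx)
  · rintro rfl
    exact hb (Finset.mem_image_of_mem _ hx)

lemma perm_ext (A : Finset ℕ) : ∀ (σ : Equiv.Perm ℕ) (F B : Finset ℕ), A.card = B.card →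
    Disjoint A F → Disjoint B (F.image σ) →
    ∃ τ : Equiv.Perm ℕ, (∀ x ∈ F, τ x = σ x) ∧ A.image τ = B := by
  induction A using Finset.induction_on with
  | empty =>
    intro σ F B h _ _
    refine ⟨σ, fun _ _ => rfl, ?_⟩
    have : B = ∅ := by rw [← Finset.card_eq_zero, ← h]; rfl
    simp [this]
  | insert a A ha ih =>
    intro σ F B h hA hB
    rw [Finset.card_insert_of_notMem ha] at h
    obtain ⟨b, hb⟩ : B.Nonempty := Finset.card_pos.mp (by omega)
    have haF : a ∉ F := Finset.disjoint_left.mp hA (Finset.mem_insert_self _ _)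
    obtain ⟨σ', h1, h2⟩ := perm_step σ F a b haF (Finset.disjoint_left.mp hB hb)
    obtain ⟨τ, h3, h4⟩ := ih σ' (insert a F) (B.erase b) (by rw [Finset.card_erase_of_mem hb]; omega) (by
      rw [Finset.disjoint_insert_right]
      exact ⟨ha, hA.mono_left (Finset.subset_insert _ _)⟩) (by
      rw [Finset.image_insert, h2, Finset.disjoint_insert_right]
      refine ⟨by simp, ?_⟩
      rw [Finset.image_congr (g := σ) (fun x hx => h1 x hx)]
      exact hB.mono_left (Finset.erase_subset _ _))
    refine ⟨τ, fun x hx => ?_, ?_⟩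
    · rw [h3 x (Finset.mem_insert_of_mem hx), h1 x hx]
    · rw [Finset.image_insert, h4, h3 a (Finset.mem_insert_self _ _), h2, Finset.insert_erase hb]

lemma eSupp_image (σ : Equiv.Perm ℕ) (I : Set (Sym2 ℕ)) : eSupp (Sym2.map σ '' I) = σ '' eSupp I := by
  ext x
  constructor
  · rintro ⟨_, ⟨e, he, rfl⟩, hx⟩
    rw [Sym2.mem_map] at hx
    obtain ⟨y, hy, rfl⟩ := hx
    exact ⟨y, ⟨e, he, hy⟩, rfl⟩
  · rintro ⟨y, ⟨e, he, hy⟩, rfl⟩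
    exact ⟨_, ⟨e, he, rfl⟩, Sym2.mem_map.mpr ⟨y, hy, rfl⟩⟩

lemma indep_subset_clique {I : Set (Sym2 ℕ)} (hI : N.M.Indep I) {V : Set ℕ} (h : eSupp I ⊆ V) :
    I ⊆ clique V :=
  fun e he => ⟨mem_ground.mp (hI.subset_ground he), fun v hv => h ⟨e, he, hv⟩⟩

/-- adding a vertex increases the rank by at most `d` -/
lemma step_bound {d : ℕ} (h : ¬ Zx N (d + 1)) (hd : Zx N d) : ∃ t : ℕ, ∀ V : Finset ℕ, t ≤ V.card → ∀ v, v ∉ V →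
    ∀ B, N.M.IsBasis B (clique (V : Set ℕ)) → ∀ T ⊆ V, N.M.Indep (B ∪ star v T) → T.card ≤ d := by
  unfold Zx at h
  push Not at h
  obtain ⟨I0, hI0f, hI0, v0, hv0, T0, hv0T, hT0, hbad⟩ := h
  have hT0c : T0.card = d + 1 := by
    by_contra hne
    exact hbad (hd I0 hI0f hI0 v0 hv0 T0 hv0T (by omega))
  set Q0 : Finset ℕ := (eSupp_finite hI0f).toFinset \ T0 with hQ0
  refine ⟨T0.card + Q0.card, fun V hV v hvV B hB T hTV hind => ?_⟩
  by_contra hlt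
  obtain ⟨T1, hT1, hT1c⟩ := Finset.exists_subset_card_eq (show d + 1 ≤ T.card by omega)
  have hT1V : T1 ⊆ V := hT1.trans hTV
  obtain ⟨Q, hQ, hQc⟩ := Finset.exists_subset_card_eq (s := V \ T1) (n := Q0.card) (by
    rw [Finset.card_sdiff_of_subset hT1V]; omega)
  have hv0Q : v0 ∉ Q0 := by simp [hQ0, hv0]
  obtain ⟨σ1, -, h1⟩ := perm_step 1 ∅ v0 v (by simp) (by simp)
  obtain ⟨σ2, h2, h2'⟩ := perm_ext T0 σ1 {v0} T1 (by omega) (by simpa using hv0T) (by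
    simp only [Finset.image_singleton, h1, Finset.disjoint_singleton_right]
    exact fun hh => hvV (hT1V hh))
  obtain ⟨σ, h3, h3'⟩ := perm_ext Q0 σ2 (insert v0 T0) Q (by omega) (by
    rw [Finset.disjoint_insert_right]
    exact ⟨hv0Q, Finset.sdiff_disjoint⟩) (by
    rw [Finset.image_insert, h2', h2 v0 (by simp), h1, Finset.disjoint_insert_right]
    refine ⟨fun hh => hvV (Finset.mem_sdiff.mp (hQ hh)).1, ?_⟩
    exact Finset.sdiff_disjoint.mono_left hQ)
  have hσv : σ v0 = v := by rw [h3 v0 (by simp), h2 v0 (by simp), h1]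
  have hσT : T0.image σ = T1 := by
    rw [Finset.image_congr (g := σ2) (fun x hx => h3 x (Finset.mem_insert_of_mem hx)), h2']
  have hσI : N.M.Indep (Sym2.map σ '' I0) := N.invariant σ _ hI0
  have hσIV : Sym2.map σ '' I0 ⊆ clique (V : Set ℕ) := by
    apply indep_subset_clique hσI
    rw [eSupp_image]
    rintro _ ⟨x, hx, rfl⟩
    by_cases hxT : x ∈ T0
    · exact hT1V (hσT ▸ Finset.mem_image_of_mem σ hxT)
    · have : σ x ∈ Q := h3' ▸ Finset.mem_image_of_mem σ (by simp [hQ0, hx, hxT])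
      exact (Finset.mem_sdiff.mp (hQ this)).1
  obtain ⟨B', hB', hIB'⟩ := hσI.subset_isBasis_of_subset hσIV (clique_subset_ground _)
  have hdj : Disjoint (clique (V : Set ℕ)) (star v T1) :=
    star_disj (fun hh => hvV (eSupp_clique (Set.Subset.refl _) hh))
  have hB1 : N.M.Indep (star v T1 ∪ B) := by
    apply hind.subset
    rw [Set.union_comm]
    exact Set.union_subset_union_right _ (star_mono hT1)
  rw [← hB.contract_indep_iff_of_disjoint hdj, hB'.contract_indep_iff_of_disjoint hdj] at hB1
  apply hbad
  rw [← indep_image_iff σ, Set.image_union, image_star, hσv, hσT, Set.union_comm]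
  exact hB1.subset (Set.union_subset_union_right _ hIB')

lemma upper_bound {d : ℕ} (h : ¬ Zx N (d + 1)) (hd : Zx N d) : ∃ K : ℕ, ∀ V : Finset ℕ, ∀ I ⊆ clique (V : Set ℕ),
    N.M.Indep I → I.ncard ≤ d * V.card + K := by
  obtain ⟨t, ht⟩ := step_bound h hd
  refine ⟨(t + 1) * (t + 1), fun V => ?_⟩
  induction V using Finset.induction_on with
  | empty =>
    intro I hI _
    have := Set.ncard_le_ncard hI (clique_finite ∅)
    have h2 := clique_ncard_le ∅
    have h3 : 1 ≤ (t + 1) * (t + 1) := Nat.mul_pos (by omega) (by omega)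
    simp at h2 ⊢
    simp at this
    omega
  | insert v V hv ih =>
    intro I hI hind
    by_cases hc : (insert v V).card ≤ t
    · have := Set.ncard_le_ncard hI (clique_finite _)
      have h2 := clique_ncard_le (insert v V)
      have h3 := Nat.mul_le_mul (Nat.add_le_add_right hc 1) (Nat.add_le_add_right hc 1)
      omega
    rw [Finset.card_insert_of_notMem hv] at hc ⊢
    have hsub : clique (V : Set ℕ) ⊆ clique ((insert v V : Finset ℕ) : Set ℕ) := clique_mono (by simp)
    obtain ⟨B, hB⟩ := N.M.exists_isBasis (clique (V : Set ℕ)) (clique_subset_ground _)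
    obtain ⟨J, hJ, hBJ⟩ := hB.indep.subset_isBasis_of_subset (hB.subset.trans hsub) (clique_subset_ground _)
    have hle := indep_finite_le N.M hJ (clique_finite _) hind hI
    set T := V.filter (fun x => s(v, x) ∈ J) with hT
    have hBT : B ∪ star v T ⊆ J := by
      apply Set.union_subset hBJ
      intro e he
      obtain ⟨x, hx, rfl⟩ := mem_star.mp he
      exact (Finset.mem_filter.mp hx).2
    have hJB : J ⊆ B ∪ star v T := by
      intro e he
      by_cases hve : v ∈ e
      · obtain ⟨x, rfl⟩ := hve
        right
        have := hJ.subset he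
        rw [mk_mem_clique] at this
        have hx : x ∈ V := by
          have := this.2.2
          simp only [Finset.coe_insert, Set.mem_insert_iff, Finset.mem_coe] at this
          rcases this with rfl | h
          · exact absurd rfl ‹_ ∧ _›.1
          · exact h
        exact mem_star.mpr ⟨x, Finset.mem_filter.mpr ⟨hx, he⟩, rfl⟩
      · left
        have heV : e ∈ clique (V : Set ℕ) := by
          have h1 := hJ.subset he
          refine ⟨h1.1, fun x hx => ?_⟩
          have := h1.2 x hx
          simp only [Finset.coe_insert, Set.mem_insert_iff] at this
          rcases this with rfl | h
          · exact absurd hx hve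
          · exact h
        have : J ∩ clique (V : Set ℕ) ⊆ B := by
          rw [hB.eq_of_subset_indep (hJ.indep.subset Set.inter_subset_left) (J := J ∩ clique (V : Set ℕ))
            (Set.subset_inter hBJ hB.subset) Set.inter_subset_right]
        exact this ⟨he, heV⟩
    have hTc := ht V (by omega) v hv B hB T (Finset.filter_subset _ _) (hJ.indep.subset hBT)
    have h1 := ih B hB.subset hB.indep
    have h2 : J.ncard ≤ B.ncard + T.card := by
      rw [← star_ncard v T]
      exact (Set.ncard_le_ncard hJB (((clique_finite V).subset hB.subset).union (star_finite v T))).trans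
        (Set.ncard_union_le _ _)
    have : d * (V.card + 1) = d * V.card + d := by ring
    omega

/-- Distributing a finite set. -/
lemma allot {k : ℕ} (n : Fin k → ℕ) : ∀ T : Finset ℕ, T.card ≤ ∑ i, n i →
    ∃ Ti : Fin k → Finset ℕ, (∀ i, Ti i ⊆ T) ∧ (∀ i, (Ti i).card ≤ n i) ∧ ∀ x ∈ T, ∃ i, x ∈ Ti i := by
  induction k with
  | zero =>
    intro T hT
    have : T = ∅ := by simpa using hT
    subst this
    exact ⟨fun _ => ∅, by simp, by simp, by simp⟩
  | succ k ih =>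
    intro T hT
    rw [Fin.sum_univ_succ] at hT
    obtain ⟨A, hA, hAc⟩ := Finset.exists_subset_card_eq (s := T) (n := min (n 0) T.card) (by omega)
    obtain ⟨Ti, h1, h2, h3⟩ := ih (fun i => n i.succ) (T \ A) (by
      rw [Finset.card_sdiff_of_subset hA]; omega)
    refine ⟨Fin.cons A Ti, fun i => ?_, fun i => ?_, fun x hx => ?_⟩
    · refine Fin.cases ?_ (fun i => ?_) i
      · simpa using hA
      · simpa using (h1 i).trans Finset.sdiff_subset
    · refine Fin.cases ?_ (fun i => ?_) i
      · simp only [Fin.cons_zero]; omega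
      · simpa using h2 i
    · by_cases hxA : x ∈ A
      · exact ⟨0, by simpa using hxA⟩
      · obtain ⟨i, hi⟩ := h3 x (Finset.mem_sdiff.mpr ⟨hx, hxA⟩)
        exact ⟨i.succ, by simpa using hi⟩
end LYU
namespace LYU
open Classical

lemma union_indep {k : ℕ} {M : GraphMatroidFamily} {Ms : Fin k → GraphMatroidFamily} (hU : M.IsUnionOf Ms)
    (Is : Fin k → Set (Sym2 ℕ)) (h : ∀ i, (Ms i).M.Indep (Is i)) {I : Set (Sym2 ℕ)}
    (hI : I ⊆ ⋃ i, Is i) : M.M.Indep I :=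
  Matroid.Indep.subset ((hU (⋃ i, Is i)).mpr ⟨Is, h, rfl⟩) hI

lemma union_Zx {k : ℕ} {M : GraphMatroidFamily} {Ms : Fin k → GraphMatroidFamily} (hU : M.IsUnionOf Ms)
    (d : Fin k → ℕ) (hd : ∀ i, Zx (Ms i) (d i)) : Zx M (∑ i, d i) := by
  intro I hIf hI v hv T hvT hT
  obtain ⟨Is, hIs, hIe⟩ := (hU I).mp hI
  have hsub : ∀ i, Is i ⊆ I := fun i => hIe ▸ Set.subset_iUnion Is i
  obtain ⟨Ti, h1, h2, h3⟩ := allot d T hT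
  refine union_indep hU (fun i => Is i ∪ star v (Ti i)) (fun i => ?_) ?_
  · exact hd i (Is i) (hIf.subset (hsub i)) (hIs i) v (fun h => hv (eSupp_mono (hsub i) h)) (Ti i)
      (fun h => hvT (h1 i h)) (h2 i)
  · rintro e (he | he)
    · rw [hIe] at he
      obtain ⟨i, hi⟩ := Set.mem_iUnion.mp he
      exact Set.mem_iUnion.mpr ⟨i, Or.inl hi⟩
    · obtain ⟨x, hx, rfl⟩ := mem_star.mp he
      obtain ⟨i, hi⟩ := h3 x hx
      exact Set.mem_iUnion.mpr ⟨i, Or.inr (mem_star.mpr ⟨x, hi, rfl⟩)⟩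

lemma union_gain {k : ℕ} {M : GraphMatroidFamily} {Ms : Fin k → GraphMatroidFamily} (hU : M.IsUnionOf Ms)
    (d c : Fin k → ℕ) (hd : ∀ i, Zx (Ms i) (d i)) (hc : ∀ i, LYc (Ms i) (c i))
    {I : Set (Sym2 ℕ)} (hI : I.Finite)
    {S : Finset ℕ} (hS : ∑ i, c i + ∑ i, d i + 2 ≤ S.card) {e : Sym2 ℕ}
    (heI : e ∉ I) (he : e ∈ clique (S : Set ℕ)) (hIe : M.M.Indep (insert e I))
    {v : ℕ} (hvI : v ∉ eSupp I) (hvS : v ∉ S) :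
    ∃ T ⊆ S, T.card = ∑ i, d i + 1 ∧ M.M.Indep (I ∪ star v T) := by
  obtain ⟨Js, hJs, hJe⟩ := (hU _).mp hIe
  obtain ⟨j, hj⟩ := Set.mem_iUnion.mp (hJe ▸ Set.mem_insert e I)
  have hsub : ∀ i, Js i \ {e} ⊆ I := by
    rintro i f ⟨hf, hfe⟩
    have : f ∈ insert e I := hJe ▸ Set.mem_iUnion.mpr ⟨i, hf⟩
    rcases this with h | h
    · exact absurd h hfe
    · exact h
  have hcj : c j ≤ ∑ i, c i := Finset.single_le_sum (fun _ _ => Nat.zero_le _) (Finset.mem_univ j)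
  have hdj : d j ≤ ∑ i, d i := Finset.single_le_sum (fun _ _ => Nat.zero_le _) (Finset.mem_univ j)
  obtain ⟨A, hAS, hAc, hA⟩ := (hd j).gain (hc j) (hI.subset (hsub j)) (S := S) (by omega) (e := e)
    (by simp) he (by rw [Set.insert_sdiff_singleton, Set.insert_eq_of_mem hj]; exact hJs j)
    (v := v) (fun h => hvI (eSupp_mono (hsub j) h)) hvS
  obtain ⟨B, hBS, hBc⟩ := Finset.exists_subset_card_eq (s := S \ A) (n := ∑ i, d i - d j) (by
    rw [Finset.card_sdiff_of_subset hAS]; omega)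
  have hsum : ∑ i, d i = (∑ i, if i = j then 0 else d i) + d j := by
    have : ∀ i, d i = (if i = j then 0 else d i) + (if i = j then d i else 0) := by
      intro i; split_ifs <;> simp
    rw [Finset.sum_congr rfl (fun i _ => this i), Finset.sum_add_distrib]
    simp
  obtain ⟨Ti, h1, h2, h3⟩ := allot (fun i => if i = j then 0 else d i) B (by omega)
  have hdAB : Disjoint A B := Finset.disjoint_sdiff.mono_right hBS
  refine ⟨A ∪ B, Finset.union_subset hAS (hBS.trans Finset.sdiff_subset), ?_, ?_⟩
  · rw [Finset.card_union_of_disjoint hdAB]; omega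
  refine union_indep hU (fun i => (Js i \ {e}) ∪ star v (if i = j then A else Ti i)) (fun i => ?_) ?_
  · by_cases hij : i = j
    · subst hij
      simpa using hA
    · simp only [if_neg hij]
      have := h2 i
      simp only [if_neg hij] at this
      exact hd i _ (hI.subset (hsub i)) ((hJs i).subset Set.sdiff_subset) v
        (fun h => hvI (eSupp_mono (hsub i) h)) (Ti i)
        (fun h => hvS (Finset.sdiff_subset (hBS (h1 i h)))) this
  · rintro f (hf | hf)
    · have : f ∈ ⋃ i, Js i := hJe ▸ Set.mem_insert_of_mem e hf
      obtain ⟨i, hi⟩ := Set.mem_iUnion.mp this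
      exact Set.mem_iUnion.mpr ⟨i, Or.inl ⟨hi, fun h => heI (h ▸ hf)⟩⟩
    · obtain ⟨x, hx, rfl⟩ := mem_star.mp hf
      rcases Finset.mem_union.mp hx with hx | hx
      · exact Set.mem_iUnion.mpr ⟨j, Or.inr (mem_star.mpr ⟨x, by simpa using hx, rfl⟩)⟩
      · obtain ⟨i, hi⟩ := h3 x hx
        have hij : i ≠ j := by
          rintro rfl
          have := h2 i
          simp at this
          simp [this] at hi
        exact Set.mem_iUnion.mpr ⟨i, Or.inr (mem_star.mpr ⟨x, by simpa [hij] using hi, rfl⟩)⟩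

lemma union_upper {k : ℕ} {M : GraphMatroidFamily} {Ms : Fin k → GraphMatroidFamily} (hU : M.IsUnionOf Ms)
    (d K : Fin k → ℕ) (hK : ∀ i, ∀ V : Finset ℕ, ∀ I ⊆ clique (V : Set ℕ),
      (Ms i).M.Indep I → I.ncard ≤ d i * V.card + K i)
    (V : Finset ℕ) (I : Set (Sym2 ℕ)) (hIV : I ⊆ clique (V : Set ℕ)) (hI : M.M.Indep I) :
    I.ncard ≤ (∑ i, d i) * V.card + ∑ i, K i := by
  obtain ⟨Is, hIs, hIe⟩ := (hU I).mp hI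
  have hsub : ∀ i, Is i ⊆ I := fun i => hIe ▸ Set.subset_iUnion Is i
  have hfin : ∀ i, (Is i).Finite := fun i => (clique_finite V).subset ((hsub i).trans hIV)
  have h1 : I.ncard ≤ ∑ i, (Is i).ncard := by
    have : I = ((Finset.univ.biUnion (fun i => (hfin i).toFinset) : Finset (Sym2 ℕ)) : Set (Sym2 ℕ)) := by
      ext f; simp [hIe]
    rw [this, Set.ncard_coe_finset]
    refine Finset.card_biUnion_le.trans (Finset.sum_le_sum fun i _ => ?_)
    rw [Set.ncard_eq_toFinset_card _ (hfin i)]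
  refine h1.trans ?_
  rw [Finset.sum_mul, ← Finset.sum_add_distrib]
  exact Finset.sum_le_sum fun i _ => hK i V (Is i) ((hsub i).trans hIV) (hIs i)

/-- closure edges inside `W` -/
def Hc (M : GraphMatroidFamily) (E : Set (Sym2 ℕ)) (W : Finset ℕ) : Set (Sym2 ℕ) :=
  clique (W : Set ℕ) ∩ M.M.closure E

lemma Hc_finite (M : GraphMatroidFamily) (E : Set (Sym2 ℕ)) (W : Finset ℕ) : (Hc M E W).Finite :=
  (clique_finite W).subset Set.inter_subset_left

lemma Hc_ground (M : GraphMatroidFamily) (E : Set (Sym2 ℕ)) (W : Finset ℕ) : Hc M E W ⊆ M.M.E :=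
  Set.inter_subset_left.trans (clique_subset_ground _)

lemma Hc_step {M : GraphMatroidFamily} {E : Set (Sym2 ℕ)} {W : Finset ℕ} {v : ℕ} (hv : v ∉ W)
    {I : Set (Sym2 ℕ)} (hI : M.M.IsBasis I (Hc M E W)) {T : Finset ℕ} (hT : T ⊆ W)
    (hadj : ∀ x ∈ T, s(v, x) ∈ M.M.closure E) (hind : M.M.Indep (I ∪ star v T)) :
    mrk M.M (Hc M E W) + T.card ≤ mrk M.M (Hc M E (insert v W)) := by
  have hvI : v ∉ eSupp I := fun h =>
    hv (eSupp_clique (hI.subset.trans Set.inter_subset_left) h)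
  obtain ⟨J, hJ⟩ := M.M.exists_isBasis (Hc M E (insert v W)) (Hc_ground M E _)
  rw [mrk_eq _ hI (Hc_finite M E W), mrk_eq _ hJ (Hc_finite M E _), ← star_ncard v T,
    ← Set.ncard_union_eq (star_disj hvI) ((Hc_finite M E W).subset hI.subset) (star_finite v T)]
  apply indep_finite_le _ hJ (Hc_finite M E _) hind
  apply Set.union_subset
  · refine hI.subset.trans (Set.inter_subset_inter_left _ (clique_mono (by simp)))
  · intro f hf
    obtain ⟨x, hx, rfl⟩ := mem_star.mp hf
    refine ⟨?_, hadj x hx⟩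
    rw [mk_mem_clique]
    exact ⟨fun h => hv (h ▸ hT hx), by simp, by simp [hT hx]⟩

theorem main {k : ℕ} (M : GraphMatroidFamily)
    (Ms : Fin k → GraphMatroidFamily) (hU : M.IsUnionOf Ms)
    (h : ∀ i, (Ms i).LovaszYemini) : M.LovaszYemini := by
  choose c hc using h
  have hc' : ∀ i, LYc (Ms i) (c i) := hc
  choose d hd hd' using fun i => exists_d (hc' i)
  choose K hK using fun i => upper_bound (hd' i) (hd i)
  set D := ∑ i, d i with hD
  set s0 := ∑ i, c i + D + 2 with hs0
  set s := (D + 1) * s0 + 2 * D + (∑ i, K i) + s0 + D + 1 with hs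
  set C := 2 + 2 * s + 16 * (D + 1) * (16 * (D + 1) * s) + 4 * (∑ i, K i) + D with hC
  refine ⟨C, fun E hE hconn => ?_⟩
  have hEg : E ⊆ M.M.E := fun e he => mem_ground.mpr (hE.2 e he)
  have hEcl : E ⊆ M.M.closure E := M.M.subset_closure E hEg
  have hfin := eSupp_finite hE.1
  set V := hfin.toFinset with hV
  have hVc : (V : Set ℕ) = eSupp E := by simp [hV]
  have key := core V (fun x y => x ≠ y ∧ s(x, y) ∈ M.M.closure E)
    (fun x y hxy => ⟨hxy.1.symm, by rw [Sym2.eq_swap]; exact hxy.2⟩) (fun x hx => hx.1 rfl)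
    (fun W => mrk M.M (Hc M E W)) D (∑ i, K i) s0 s C ?_ ?_ ?_ rfl rfl ?_ ?_
  · unfold GraphMatroidFamily.Rigid GraphMatroidFamily.rk
    rw [← hVc]
    apply mrk_of_subset_closure _ _ (clique_finite V) (clique_subset_ground _)
    · intro e he
      induction e with
      | _ x y =>
        rw [mk_mem_clique] at he
        exact (key x (by exact_mod_cast he.2.1) y (by exact_mod_cast he.2.2) he.1).2
    · intro e he
      exact ⟨hE.2 e he, fun v hv => hVc ▸ ⟨e, he, hv⟩⟩
  · intro W _ v _ hvW hcard
    obtain ⟨F, hcard, hF⟩ : ∃ F : Finset ℕ, D ≤ F.card ∧ ∀ z, z ∈ F ↔ z ∈ W ∧ v ≠ z ∧ s(v, z) ∈ M.M.closure E :=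
      ⟨_, hcard, fun z => by simp only [Finset.mem_filter]⟩
    have hFW : F ⊆ W := fun z hz => ((hF z).mp hz).1
    obtain ⟨T, hT, hTc⟩ := Finset.exists_subset_card_eq hcard
    obtain ⟨I, hI⟩ := M.M.exists_isBasis (Hc M E W) (Hc_ground M E W)
    have hTW : T ⊆ W := hT.trans hFW
    have := Hc_step hvW hI hTW (fun x hx => ((hF x).mp (hT hx)).2.2)
      (union_Zx hU d hd I ((Hc_finite M E W).subset hI.subset) hI.indep v
        (fun h => hvW (eSupp_clique (hI.subset.trans Set.inter_subset_left) h)) T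
        (fun h => hvW (hTW h)) hTc.le)
    rwa [hTc] at this
  · intro W _ v _ hvW hcard x hx y hy hvx hvy hxy hnadj
    obtain ⟨F, hcard, hF⟩ : ∃ F : Finset ℕ, s0 ≤ F.card ∧ ∀ z, z ∈ F ↔ z ∈ W ∧ v ≠ z ∧ s(v, z) ∈ M.M.closure E :=
      ⟨_, hcard, fun z => by simp only [Finset.mem_filter]⟩
    have hFW : F ⊆ W := fun z hz => ((hF z).mp hz).1
    obtain ⟨I, hI⟩ := M.M.exists_isBasis (Hc M E W) (Hc_ground M E W)
    have hncl : s(x, y) ∉ M.M.closure E := fun h => hnadj ⟨hxy, h⟩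
    have hIcl : I ⊆ M.M.closure E := hI.subset.trans Set.inter_subset_right
    have hg : s(x, y) ∈ M.M.E := mem_ground.mpr (by simpa using hxy)
    have hncl2 : s(x, y) ∉ M.M.closure I := fun h =>
      hncl (M.M.closure_subset_closure_of_subset_closure hIcl h)
    have hIe := ((hI.indep.notMem_closure_iff hg).mp hncl2).1
    obtain ⟨T, hTS, hTc, hT⟩ := union_gain hU d c hd hc' ((Hc_finite M E W).subset hI.subset)
      (S := F) hcard (e := s(x, y))
      (fun h => hncl (hIcl h)) (by
        rw [mk_mem_clique]
        refine ⟨hxy, ?_, ?_⟩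
        · exact (hF x).mpr ⟨hx, hvx⟩
        · exact (hF y).mpr ⟨hy, hvy⟩) hIe (v := v)
      (fun h => hvW (eSupp_clique (hI.subset.trans Set.inter_subset_left) h))
      (fun h => hvW (hFW h))
    have := Hc_step hvW hI (hTS.trans hFW)
      (fun x hx => ((hF x).mp (hTS hx)).2.2) hT
    rwa [hTc] at this
  · intro W _
    obtain ⟨I, hI⟩ := M.M.exists_isBasis (Hc M E W) (Hc_ground M E W)
    simp only [mrk_eq _ hI (Hc_finite M E W)]
    exact union_upper hU d K hK W I (hI.subset.trans Set.inter_subset_left) hI.indep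
  · have := hconn.1
    rwa [← hVc, Set.ncard_coe_finset] at this
  · rintro S hS X hX ⟨x, hxX⟩ hXS ⟨y, hyV, hyX, hyS⟩ hno
    by_contra hlt
    have hcon := hconn.2 S (by omega)
    have hxS : x ∉ S := Finset.disjoint_left.mp hXS hxX
    have hxE : x ∈ eSupp E \ ↑S := ⟨hVc ▸ hX hxX, hxS⟩
    have hyE : y ∈ eSupp E \ ↑S := ⟨hVc ▸ hyV, hyS⟩
    obtain ⟨p⟩ := hcon.preconnected ⟨x, hxE⟩ ⟨y, hyE⟩
    obtain ⟨dt, _, h1, h2⟩ := p.exists_boundary_dart {z | z.1 ∈ X} hxX hyX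
    have hadj := dt.adj
    simp only [SimpleGraph.comap_adj, SimpleGraph.fromEdgeSet_adj, Function.Embedding.subtype_apply] at hadj
    refine hno dt.fst.1 h1 dt.snd.1 ?_ h2 dt.snd.2.2 ⟨hadj.2, hEcl hadj.1⟩
    exact hfin.mem_toFinset.mpr dt.snd.2.1
end LYU
/-- If each of the graph matroid families `M₁, …, M_k` has the
Lovász–Yemini property, then so does their union. -/
theorem lovaszYemini_of_union {k : ℕ} (M : GraphMatroidFamily)
    (Ms : Fin k → GraphMatroidFamily) (hU : M.IsUnionOf Ms)
    (h : ∀ i, (Ms i).LovaszYemini) : M.LovaszYemini := by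
  exact LYU.main M Ms hU h
end
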